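/- Let φ : X → ℝ be a normalized potential with summable variation, not of the form u − u∘θ − log|A| for continuous u, with unique equilibrium state μ_φ. Then for every u ∈ [0, h(μ_φ) + ∫ φ dμ_{(1−q*_φ)φ}), lim_n (1/n) log μ_φ({x : (1/n) log R_n(x) < h(μ_φ) − u}) = −ℐ_φ(h(μ_φ) − u). -/

import Mathlib

open MeasureTheory Filter Topology Set

namespace RTSpec

variable (A : Type*) [Fintype A] [TopologicalSpace A] [DiscreteTopology A]
  [MeasurableSpace A] [BorelSpace A]

/-- The sequence space `X = A^ℕ` (0-indexed: `x 0` is the paper's `x₁`). -/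
abbrev X := ℕ → A

/-- The shift map `θ`. -/
def shift : X A → X A := fun x n => x (n + 1)

/-- The cylinder `[a_1^n]` based on the word `w = a_1^n`. -/
def cyl {n : ℕ} (w : Fin n → A) : Set (X A) := {x | ∀ i : Fin n, x i.val = w i}

/-- Return time `R_n(x) = inf {k ≥ 2 : x_k^{k+n-1} = x_1^n}` (with `sInf ∅ = 0`). -/
noncomputable def retTime (n : ℕ) (x : X A) : ℕ := sInf {k | 2 ≤ k ∧ ∀ i < n, x (k - 1 + i) = x i}

/-- Hitting time `T_{a_1^n}(y) = inf {k ≥ 1 : y_k^{k+n-1} = a_1^n}`. -/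
noncomputable def hitTime {n : ℕ} (w : Fin n → A) (y : X A) : ℕ :=
  sInf {k | 1 ≤ k ∧ ∀ i : Fin n, y (k - 1 + i.val) = w i}

/-- Hitting/return time in the shifted sense: `inf {k ≥ 1 : θ^k y ∈ [a_1^n]}`. -/
noncomputable def hitTime' {n : ℕ} (w : Fin n → A) (y : X A) : ℕ :=
  sInf {k | 1 ≤ k ∧ ∀ i : Fin n, y (k + i.val) = w i}

/-- `τ(a_1^n) = inf {k ≥ 1 : [a_1^n] ∩ θ^{-k}[a_1^n] ≠ ∅}`, the smallest return time
of the cylinder `[a_1^n]`. -/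
noncomputable def tau {n : ℕ} (w : Fin n → A) : ℕ :=
  sInf {k | 1 ≤ k ∧ (cyl A w ∩ {y | ∀ i : Fin n, y (k + i.val) = w i}).Nonempty}

/-- `ζ_μ(a_1^n) = μ([a_1^n] ∩ {T_{a_1^n} ≠ τ(a_1^n)}) / μ([a_1^n])`. -/
noncomputable def zeta (μ : Measure (X A)) {n : ℕ} (w : Fin n → A) : ℝ :=
  (μ (cyl A w ∩ {y | hitTime' A w y ≠ tau A w})).toReal / (μ (cyl A w)).toReal

/-- A shift-invariant Borel probability measure. -/
def InvProb (η : Measure (X A)) : Prop :=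
  IsProbabilityMeasure η ∧ Measure.map (shift A) η = η

/-- The `n`-th term `-(1/n) Σ_{a_1^n} μ(a_1^n) log μ(a_1^n)` of the entropy sequence. -/
noncomputable def entSeq (μ : Measure (X A)) (n : ℕ) : ℝ :=
  -(1 / (n : ℝ)) * ∑ w : Fin n → A, (μ (cyl A w)).toReal * Real.log (μ (cyl A w)).toReal

/-- The entropy `h(μ)`, i.e. the limit of `entSeq` (which always exists for a
shift-invariant measure; we realize it as a liminf). -/
noncomputable def entropy (μ : Measure (X A)) : ℝ := atTop.liminf (entSeq A μ)

/-- Topological pressure `P(ψ) = sup_η {h(η) + ∫ ψ dη}`, the supremum running over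
all shift-invariant probability measures. -/
noncomputable def pressure (ψ : X A → ℝ) : ℝ :=
  sSup {r | ∃ η : Measure (X A), InvProb A η ∧ r = entropy A η + ∫ x, ψ x ∂η}

/-- `sup_η ∫ φ dη` over shift-invariant probability measures. -/
noncomputable def supInt (φ : X A → ℝ) : ℝ :=
  sSup {r | ∃ η : Measure (X A), InvProb A η ∧ r = ∫ x, φ x ∂η}

/-- `inf_η ∫ φ dη` over shift-invariant probability measures. -/
noncomputable def infInt (φ : X A → ℝ) : ℝ :=
  sInf {r | ∃ η : Measure (X A), InvProb A η ∧ r = ∫ x, φ x ∂η}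

/-- `var_n(φ) = sup {|φ(x) - φ(y)| : x_1^n = y_1^n}`. -/
noncomputable def Var (φ : X A → ℝ) (n : ℕ) : ℝ :=
  sSup {r | ∃ x y : X A, (∀ i < n, x i = y i) ∧ r = |φ x - φ y|}

/-- Prepending a symbol: `ax = (a, x_1, x_2, …)`. -/
def prepend (a : A) (x : X A) : X A := fun n => Nat.casesOn n a x

/-- A potential `φ` is normalized if `Σ_{a ∈ A} e^{φ(ax)} = 1` for all `x`. -/
def Normalized (φ : X A → ℝ) : Prop :=
  ∀ x : X A, ∑ a : A, Real.exp (φ (prepend A a x)) = 1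

/-- `μ` is an equilibrium state for `φ`: a probability measure fixed by the dual
transfer operator, i.e. `∫ L_φ f dμ = ∫ f dμ` for every continuous `f`. -/
def IsEqSt (φ : X A → ℝ) (μ : Measure (X A)) : Prop :=
  IsProbabilityMeasure μ ∧ ∀ f : X A → ℝ, Continuous f →
    ∫ x, (∑ a : A, Real.exp (φ (prepend A a x)) * f (prepend A a x)) ∂μ = ∫ x, f x ∂μ

/-- The `n`-th term `(1/n) log ∫ R_n^q dμ` of the return-time `L^q`-spectrum,
with values in `EReal` (the integral may be infinite). -/
noncomputable def RSeq (μ : Measure (X A)) (q : ℝ) (n : ℕ) : EReal :=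
  (((n : ℝ)⁻¹ : ℝ) : EReal) *
    ENNReal.log (∫⁻ x, ENNReal.ofReal ((retTime A n x : ℝ) ^ q) ∂μ)

/-- The `n`-th term `(1/n) log Σ_{a_1^n} μ(a_1^n)^{1-q}` of the `L^q`-spectrum of `μ`. -/
noncomputable def MSeq (μ : Measure (X A)) (q : ℝ) (n : ℕ) : ℝ :=
  (1 / (n : ℝ)) * Real.log (∑ w : Fin n → A, (μ (cyl A w)).toReal ^ (1 - q))

/-- `Λ^{(n)}(μ) = (1/n) log Σ_{a_1^n} (1 - ζ_μ(a_1^n)) μ(a_1^n)`. -/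
noncomputable def LamSeq (μ : Measure (X A)) (n : ℕ) : ℝ :=
  (1 / (n : ℝ)) * Real.log (∑ w : Fin n → A, (1 - zeta A μ w) * (μ (cyl A w)).toReal)

/-- `(1/n) log max_{a_1^n} μ(a_1^n)`. -/
noncomputable def gammaSeq (μ : Measure (X A)) (n : ℕ) : ℝ :=
  (1 / (n : ℝ)) * Real.log (⨆ w : Fin n → A, (μ (cyl A w)).toReal)

/-- `μ` is φ-mixing with rate `ϕ`: `ϕ` decreases to `0` and for all `n, ℓ ≥ 1`,
all `S` in the σ-algebra generated by coordinates `1, …, n` with `μ S ≠ 0`, and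
all `T` in the σ-algebra generated by coordinates `n+ℓ, n+ℓ+1, …`,
`|μ(S ∩ T)/μ(S) - μ(T)| ≤ ϕ(ℓ)`. -/
def PhiMixing (μ : Measure (X A)) (ϕ : ℕ → ℝ) : Prop :=
  (∀ ℓ, 0 < ϕ ℓ) ∧ Antitone ϕ ∧ Tendsto ϕ atTop (nhds 0) ∧
  ∀ n ℓ : ℕ, 1 ≤ n → 1 ≤ ℓ →
    ∀ S T : Set (X A),
      MeasurableSet[MeasurableSpace.comap
        (fun x : X A => fun i : Fin n => x i.val) inferInstance] S →
      MeasurableSet[MeasurableSpace.comap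
        (fun x : X A => fun j : ℕ => x (n + ℓ - 1 + j)) inferInstance] T →
      μ S ≠ 0 →
      |(μ (S ∩ T)).toReal / (μ S).toReal - (μ T).toReal| ≤ ϕ ℓ

/-- The rate function `ℐ_φ(v) = sup_{q ∈ ℝ} (q v - P((1-q)φ))` for
`v < - inf_η ∫ φ dη`, and `ℐ_φ(v) = +∞` for `v ≥ - inf_η ∫ φ dη`. -/
noncomputable def rateFn (φ : X A → ℝ) : ℝ → EReal := fun v =>
  if v < -(infInt A φ) then
    ((sSup {r : ℝ | ∃ q : ℝ, r = q * v - pressure A (fun x => (1 - q) * φ x)} : ℝ) : EReal)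
  else ⊤

set_option linter.unusedSectionVars false

/-! ### Words, cylinders and the shift -/

/-- The word formed by the first `n` letters of `x`. -/
def word (n : ℕ) (x : X A) : Fin n → A := fun i => x i.val

/-- Concatenation of a finite word with a sequence. -/
def glue {n : ℕ} (w : Fin n → A) (x : X A) : X A :=
  fun i => if h : i < n then w ⟨i, h⟩ else x (i - n)

lemma shift_iterate_apply (n i : ℕ) (x : X A) : (shift A)^[n] x i = x (i + n) := by
  induction n generalizing x i with
  | zero => rfl
  | succ n ih =>
    rw [Function.iterate_succ_apply, ih]
    exact congrArg x (by omega)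

lemma shift_prepend (a : A) (x : X A) : shift A (prepend A a x) = x := rfl

lemma continuous_shift : Continuous (shift A) :=
  continuous_pi fun n => continuous_apply (n + 1)

lemma continuous_prepend (a : A) : Continuous (prepend A a) := by
  refine continuous_pi fun n => ?_
  cases n with
  | zero => exact continuous_const
  | succ n => exact continuous_apply n

lemma measurable_word (n : ℕ) : Measurable (word A n) :=
  measurable_pi_lambda _ fun i => measurable_pi_apply i.val

lemma word_preimage_singleton {n : ℕ} (w : Fin n → A) : word A n ⁻¹' {w} = cyl A w := by
  ext x
  simp [word, cyl, funext_iff]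

lemma measurableSet_cyl {n : ℕ} (w : Fin n → A) : MeasurableSet (cyl A w) := by
  rw [← word_preimage_singleton]
  exact measurable_word A n (measurableSet_singleton w)

lemma mem_cyl_word (n : ℕ) (x : X A) : x ∈ cyl A (word A n x) := fun _ => rfl

lemma glue_mem_cyl {n : ℕ} (w : Fin n → A) (x : X A) : glue A w x ∈ cyl A w := fun i => by
  simp [glue]

lemma shift_iterate_glue {n : ℕ} (w : Fin n → A) (x : X A) : (shift A)^[n] (glue A w x) = x := by
  ext i
  simp [shift_iterate_apply, glue]

lemma cyl_nonempty [Nonempty A] {n : ℕ} (w : Fin n → A) : (cyl A w).Nonempty :=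
  ⟨_, glue_mem_cyl A w (Classical.arbitrary _)⟩

lemma glue_succ {n : ℕ} (w : Fin (n + 1) → A) (x : X A) :
    glue A w x = prepend A (w 0) (glue A (Fin.tail w) x) := by
  ext i
  cases i with
  | zero => simp [glue, prepend]
  | succ i => simp [glue, prepend, Fin.tail]

lemma prepend_mem_cyl {n : ℕ} (w : Fin (n + 1) → A) (a : A) (x : X A) :
    prepend A a x ∈ cyl A w ↔ a = w 0 ∧ x ∈ cyl A (Fin.tail w) := by
  simp only [cyl, Set.mem_ofPred_eq, Fin.forall_fin_succ]
  simp [prepend, Fin.tail]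

lemma integral_word (μ : Measure (X A)) [IsProbabilityMeasure μ] (n : ℕ) (F : (Fin n → A) → ℝ) :
    ∫ x, F (word A n x) ∂μ = ∑ w, μ.real (cyl A w) * F w := by
  have : IsProbabilityMeasure (μ.map (word A n)) :=
    Measure.isProbabilityMeasure_map (measurable_word A n).aemeasurable
  rw [← integral_map (φ := word A n) (f := F) (measurable_word A n).aemeasurable
    (measurable_of_countable F).aestronglyMeasurable,
    integral_fintype (Integrable.of_finite)]
  refine Finset.sum_congr rfl fun w _ => ?_
  rw [map_measureReal_apply (measurable_word A n) (measurableSet_singleton w),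
    word_preimage_singleton, smul_eq_mul]

lemma sum_measureReal_cyl (μ : Measure (X A)) [IsProbabilityMeasure μ] (n : ℕ) :
    ∑ w : Fin n → A, μ.real (cyl A w) = 1 := by
  simpa using (integral_word A μ n fun _ => 1).symm

lemma measureReal_le_sum_cyl (μ : Measure (X A)) [IsProbabilityMeasure μ] (n : ℕ)
    (B : Set (X A)) : μ.real B ≤ ∑ w : Fin n → A, μ.real (cyl A w ∩ B) := by
  refine (measureReal_mono ?_).trans
    (measureReal_iUnion_fintype_le (fun w : Fin n → A => cyl A w ∩ B))
  exact fun x hx => Set.mem_iUnion.2 ⟨word A n x, mem_cyl_word A n x, hx⟩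

lemma pairwise_disjoint_cyl (n : ℕ) :
    Pairwise (Function.onFun Disjoint fun w : Fin n → A => cyl A w) := by
  intro w w' h
  refine Set.disjoint_left.2 fun x hx hx' => h ?_
  ext i
  rw [← hx i, hx' i]

lemma integrable_of_continuous {g : X A → ℝ} (hg : Continuous g) (μ : Measure (X A))
    [IsFiniteMeasure μ] : Integrable g μ :=
  (BoundedContinuousFunction.mkOfCompact ⟨g, hg⟩).integrable μ

/-! ### Bounded distortion and the Gibbs property -/

lemma exists_abs_le_of_continuous [Nonempty A] {φ : X A → ℝ} (hφc : Continuous φ) :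
    ∃ M, 0 ≤ M ∧ ∀ x, |φ x| ≤ M := by
  obtain ⟨M, hM⟩ := isCompact_univ.exists_bound_of_continuousOn hφc.continuousOn
  exact ⟨M, (abs_nonneg _).trans (hM (Classical.arbitrary _) (mem_univ _)),
    fun x => hM x (mem_univ x)⟩

lemma abs_sub_le_Var [Nonempty A] {φ : X A → ℝ} (hφc : Continuous φ) {n : ℕ} {x y : X A}
    (h : ∀ i < n, x i = y i) : |φ x - φ y| ≤ Var A φ n := by
  obtain ⟨M, -, hM⟩ := exists_abs_le_of_continuous A hφc
  refine le_csSup ⟨M + M, ?_⟩ ⟨x, y, h, rfl⟩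
  rintro r ⟨x, y, -, rfl⟩
  exact (abs_sub _ _).trans (add_le_add (hM x) (hM y))

lemma Var_nonneg [Nonempty A] {φ : X A → ℝ} (hφc : Continuous φ) (n : ℕ) : 0 ≤ Var A φ n :=
  (abs_nonneg _).trans (abs_sub_le_Var A hφc
    (x := Classical.arbitrary _) (y := Classical.arbitrary _) fun _ _ => rfl)

lemma abs_birkhoffSum_sub_le [Nonempty A] {φ : X A → ℝ} (hφc : Continuous φ)
    (hvar : Summable fun n => Var A φ (n + 1)) {n : ℕ} {x y : X A} (h : ∀ i < n, x i = y i) :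
    |birkhoffSum (shift A) φ n x - birkhoffSum (shift A) φ n y| ≤ ∑' k, Var A φ (k + 1) := by
  rw [birkhoffSum, birkhoffSum, ← Finset.sum_sub_distrib]
  calc _ ≤ ∑ j ∈ Finset.range n, |φ ((shift A)^[j] x) - φ ((shift A)^[j] y)| :=
        Finset.abs_sum_le_sum_abs _ _
    _ ≤ ∑ j ∈ Finset.range n, Var A φ (n - 1 - j + 1) := by
        refine Finset.sum_le_sum fun j hj => abs_sub_le_Var A hφc fun i hi => ?_
        have := Finset.mem_range.1 hj
        rw [shift_iterate_apply, shift_iterate_apply, h _ (by omega)]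
    _ = ∑ j ∈ Finset.range n, Var A φ (j + 1) :=
        Finset.sum_range_reflect (fun j => Var A φ (j + 1)) n
    _ ≤ _ := hvar.sum_le_tsum _ fun j _ => Var_nonneg A hφc _

/-- Bounded distortion of the Birkhoff sums of `φ`, together with the resulting two-sided
estimates for `μ` on cylinders conditioned on the future. -/
structure QuasiGibbs (φ : X A → ℝ) (μ : Measure (X A)) (C : ℝ) : Prop where
  nonneg : 0 ≤ C
  distortion : ∀ {n : ℕ} {x y : X A}, (∀ i < n, x i = y i) →
    birkhoffSum (shift A) φ n x ≤ birkhoffSum (shift A) φ n y + C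
  lower : ∀ {n : ℕ} (w : Fin n → A) {x : X A}, x ∈ cyl A w → ∀ {B : Set (X A)}, MeasurableSet B →
    Real.exp (birkhoffSum (shift A) φ n x - C) * μ.real B ≤
      μ.real (cyl A w ∩ (shift A)^[n] ⁻¹' B)
  upper : ∀ {n : ℕ} (w : Fin n → A) {x : X A}, x ∈ cyl A w → ∀ {B : Set (X A)}, MeasurableSet B →
    μ.real (cyl A w ∩ (shift A)^[n] ⁻¹' B) ≤
      Real.exp (birkhoffSum (shift A) φ n x + C) * μ.real B

lemma lintegral_transfer {φ : X A → ℝ} (hφc : Continuous φ) {μ : Measure (X A)}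
    (hμ : IsEqSt A φ μ) {f : X A → ENNReal} (hf : Measurable f) :
    ∫⁻ x, f x ∂μ =
      ∫⁻ x, ∑ a : A, ENNReal.ofReal (Real.exp (φ (prepend A a x))) * f (prepend A a x) ∂μ := by
  have := hμ.1
  have hcont (a : A) : Continuous fun x => Real.exp (φ (prepend A a x)) :=
    (hφc.comp (continuous_prepend A a)).rexp
  have hfin (a : A) : IsFiniteMeasure
      ((μ.withDensity fun x => ENNReal.ofReal (Real.exp (φ (prepend A a x)))).map
        (prepend A a)) := by
    have := isFiniteMeasure_withDensity_ofReal (integrable_of_continuous A (hcont a) μ).2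
    infer_instance
  have key : μ = ∑ a : A,
      (μ.withDensity fun x => ENNReal.ofReal (Real.exp (φ (prepend A a x)))).map
        (prepend A a) := by
    refine ext_of_forall_integral_eq_of_IsFiniteMeasure fun g => ?_
    rw [integral_finsetSum_measure fun a _ => g.integrable _, ← hμ.2 g g.continuous,
      integral_finsetSum]
    · refine Finset.sum_congr rfl fun a _ => ?_
      rw [integral_map (continuous_prepend A a).measurable.aemeasurable
        g.continuous.aestronglyMeasurable,
        integral_withDensity_eq_integral_toReal_smul
          (hcont a).measurable.ennreal_ofReal (by simp)]
      simp [ENNReal.toReal_ofReal (Real.exp_pos _).le]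
    · exact fun a _ => integrable_of_continuous A
        ((hcont a).mul (g.continuous.comp (continuous_prepend A a))) μ
  conv_lhs => rw [key]
  rw [lintegral_finsetSum_measure, lintegral_finsetSum]
  · refine Finset.sum_congr rfl fun a _ => ?_
    rw [lintegral_map hf (continuous_prepend A a).measurable]
    exact lintegral_withDensity_eq_lintegral_mul _ (hcont a).measurable.ennreal_ofReal
      (hf.comp (continuous_prepend A a).measurable)
  · exact fun a _ => (hcont a).measurable.ennreal_ofReal.mul
      (hf.comp (continuous_prepend A a).measurable)

lemma measurePreserving_shift {φ : X A → ℝ} (hφc : Continuous φ) (hnorm : Normalized A φ)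
    {μ : Measure (X A)} (hμ : IsEqSt A φ μ) : MeasurePreserving (shift A) μ μ := by
  refine ⟨(continuous_shift A).measurable, ?_⟩
  ext B hB
  have hm := (continuous_shift A).measurable hB
  rw [Measure.map_apply (continuous_shift A).measurable hB, ← lintegral_indicator_one hm,
    lintegral_transfer A hφc hμ (measurable_one.indicator hm), ← lintegral_indicator_one hB]
  refine lintegral_congr fun x => ?_
  have h (a : A) : (shift A ⁻¹' B).indicator (1 : X A → ENNReal) (prepend A a x) =
      B.indicator 1 x := rfl
  simp only [h]
  rw [← Finset.sum_mul, ← ENNReal.ofReal_sum_of_nonneg fun a _ => (Real.exp_pos _).le, hnorm x]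
  simp

lemma setLIntegral_cyl {φ : X A → ℝ} (hφc : Continuous φ) {μ : Measure (X A)}
    (hμ : IsEqSt A φ μ) {n : ℕ} (w : Fin n → A) {f : X A → ENNReal} (hf : Measurable f) :
    ∫⁻ x, (cyl A w).indicator f x ∂μ =
      ∫⁻ x, ENNReal.ofReal (Real.exp (birkhoffSum (shift A) φ n (glue A w x))) *
        f (glue A w x) ∂μ := by
  induction n generalizing f with
  | zero =>
    refine lintegral_congr fun x => ?_
    have : glue A w x = x := by ext i; simp [glue]
    simp [this, cyl]
  | succ n ih =>
    rw [lintegral_transfer A hφc hμ (hf.indicator (measurableSet_cyl A w))]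
    have hm := (continuous_prepend A (w 0)).measurable
    have h1 := ih (Fin.tail w)
      (f := fun x => ENNReal.ofReal (Real.exp (φ (prepend A (w 0) x))) * f (prepend A (w 0) x))
      ((((hφc.measurable.comp hm).exp).ennreal_ofReal).mul (hf.comp hm))
    convert h1 using 2
    · ext x
      rw [Finset.sum_eq_single (w 0)]
      · by_cases hx : x ∈ cyl A (Fin.tail w)
        · rw [Set.indicator_of_mem hx, Set.indicator_of_mem ((prepend_mem_cyl A w _ x).2 ⟨rfl, hx⟩)]
        · rw [Set.indicator_of_notMem hx, Set.indicator_of_notMem, mul_zero]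
          exact fun h => hx ((prepend_mem_cyl A w _ x).1 h).2
      · intro a _ ha
        rw [Set.indicator_of_notMem, mul_zero]
        exact fun h => ha ((prepend_mem_cyl A w _ x).1 h).1
      · simp
    · ext x
      rw [glue_succ, birkhoffSum_succ', shift_prepend, Real.exp_add,
        ENNReal.ofReal_mul (Real.exp_pos _).le]
      ring

lemma exists_quasiGibbs [Nonempty A] {φ : X A → ℝ} (hφc : Continuous φ)
    (hvar : Summable fun n => Var A φ (n + 1)) {μ : Measure (X A)} (hμ : IsEqSt A φ μ) :
    ∃ C, QuasiGibbs A φ μ C := by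
  have := hμ.1
  set C := ∑' k, Var A φ (k + 1) with hC
  have hdist {n : ℕ} {x y : X A} (h : ∀ i < n, x i = y i) :
      birkhoffSum (shift A) φ n x ≤ birkhoffSum (shift A) φ n y + C := by
    linarith [(abs_le.1 (abs_birkhoffSum_sub_le A hφc hvar h)).2]
  have heq {n : ℕ} (w : Fin n → A) {B : Set (X A)} (hB : MeasurableSet B) :
      μ (cyl A w ∩ (shift A)^[n] ⁻¹' B) =
        ∫⁻ x in B, ENNReal.ofReal (Real.exp (birkhoffSum (shift A) φ n (glue A w x))) ∂μ := by
    have hm := ((continuous_shift A).iterate n).measurable hB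
    rw [← lintegral_indicator_one ((measurableSet_cyl A w).inter hm),
      ← lintegral_indicator hB]
    have h1 := setLIntegral_cyl A hφc hμ w
      (f := ((shift A)^[n] ⁻¹' B).indicator 1) (measurable_one.indicator hm)
    rw [Set.indicator_indicator] at h1
    rw [h1]
    refine lintegral_congr fun x => ?_
    by_cases hx : x ∈ B <;> simp [Set.indicator, shift_iterate_glue, hx]
  have hagree {n : ℕ} {w : Fin n → A} {x y : X A} (hx : x ∈ cyl A w) (hy : y ∈ cyl A w) :
      ∀ i < n, x i = y i := fun i hi => (hx ⟨i, hi⟩).trans (hy ⟨i, hi⟩).symm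
  refine ⟨C, tsum_nonneg fun _ => Var_nonneg A hφc _, hdist, ?_, ?_⟩
  · intro n w x hx B hB
    rw [measureReal_def, measureReal_def, ← ENNReal.toReal_ofReal (Real.exp_pos _).le,
      ← ENNReal.toReal_mul]
    refine ENNReal.toReal_mono (measure_ne_top _ _) ?_
    rw [heq w hB, ← setLIntegral_const]
    refine lintegral_mono fun y => ENNReal.ofReal_le_ofReal (Real.exp_le_exp.2 ?_)
    linarith [hdist (hagree hx (glue_mem_cyl A w y))]
  · intro n w x hx B hB
    rw [measureReal_def, measureReal_def, ← ENNReal.toReal_ofReal (Real.exp_pos _).le,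
      ← ENNReal.toReal_mul]
    refine ENNReal.toReal_mono (by finiteness) ?_
    rw [heq w hB, ← setLIntegral_const]
    refine lintegral_mono fun y => ENNReal.ofReal_le_ofReal (Real.exp_le_exp.2 ?_)
    linarith [hdist (hagree (glue_mem_cyl A w y) hx)]

/-! ### Entropy estimates -/

lemma sum_negMulLog_le {ι : Type*} [Fintype ι] {p q : ι → ℝ} (hp : ∀ i, 0 ≤ p i)
    (hq : ∀ i, 0 < q i) (hsum : ∑ i, q i ≤ ∑ i, p i) :
    ∑ i, Real.negMulLog (p i) ≤ ∑ i, p i * -Real.log (q i) := by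
  have h : ∀ i, Real.negMulLog (p i) - p i * -Real.log (q i) ≤ q i - p i := by
    intro i
    rcases (hp i).eq_or_lt with h0 | h0
    · simp [← h0, (hq i).le]
    · have h1 := Real.log_le_sub_one_of_pos (div_pos (hq i) h0)
      rw [Real.log_div (hq i).ne' h0.ne'] at h1
      have h2 := mul_le_mul_of_nonneg_left h1 h0.le
      rw [mul_sub, mul_sub, mul_div_cancel₀ _ h0.ne'] at h2
      rw [Real.negMulLog]
      linarith
  have := Finset.sum_le_sum fun i (_ : i ∈ Finset.univ) => h i
  rw [Finset.sum_sub_distrib, Finset.sum_sub_distrib] at this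
  linarith

lemma entSeq_eq (μ : Measure (X A)) (n : ℕ) :
    entSeq A μ n = (1 / (n : ℝ)) * ∑ w : Fin n → A, Real.negMulLog (μ.real (cyl A w)) := by
  simp only [entSeq, Real.negMulLog, neg_mul, Finset.sum_neg_distrib, mul_neg]
  rfl

lemma entSeq_nonneg (μ : Measure (X A)) [IsProbabilityMeasure μ] (n : ℕ) :
    0 ≤ entSeq A μ n := by
  rw [entSeq_eq]
  exact mul_nonneg (by positivity) (Finset.sum_nonneg fun w _ =>
    Real.negMulLog_nonneg measureReal_nonneg measureReal_le_one)

lemma entSeq_le_log_card [Nonempty A] (μ : Measure (X A)) [IsProbabilityMeasure μ] (n : ℕ) :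
    entSeq A μ n ≤ Real.log (Fintype.card A) := by
  have hc : (0 : ℝ) < Fintype.card A := by exact_mod_cast Fintype.card_pos
  rcases n.eq_zero_or_pos with rfl | hn
  · simpa [entSeq] using Real.log_natCast_nonneg (Fintype.card A)
  rw [entSeq_eq]
  have h := sum_negMulLog_le (p := fun w : Fin n → A => μ.real (cyl A w))
    (q := fun _ => ((Fintype.card A : ℝ) ^ n)⁻¹) (fun _ => measureReal_nonneg)
    (fun _ => by positivity) (by simp [sum_measureReal_cyl, hc.ne'])
  rw [← Finset.sum_mul, sum_measureReal_cyl, Real.log_inv, Real.log_pow, neg_neg, one_mul] at h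
  have hn' : (0 : ℝ) < n := by exact_mod_cast hn
  rw [one_div, inv_mul_le_iff₀ hn']
  exact h

lemma entropy_le_of_frequently (μ : Measure (X A)) [IsProbabilityMeasure μ] {c : ℝ}
    (h : ∃ᶠ n in atTop, entSeq A μ n ≤ c) : entropy A μ ≤ c :=
  liminf_le_of_frequently_le h (isBoundedUnder_of ⟨0, entSeq_nonneg A μ⟩)

lemma le_entropy_of_tendsto [Nonempty A] (μ : Measure (X A)) [IsProbabilityMeasure μ] {c : ℝ}
    {a : ℕ → ℝ} (ha : Tendsto a atTop (𝓝 c)) (h : ∀ᶠ n in atTop, a n ≤ entSeq A μ n) :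
    c ≤ entropy A μ := by
  rw [← ha.liminf_eq]
  exact liminf_le_liminf h ha.isBoundedUnder_ge
    (isBoundedUnder_of ⟨_, entSeq_le_log_card A μ⟩).isCoboundedUnder_ge

/-! ### Block Bernoulli measures -/

section Blocks

variable {N : ℕ} [NeZero N]

/-- The sequence of letters obtained by concatenating a sequence of blocks of length `N`. -/
def unblock (b : ℕ → Fin N → A) : X A := fun i => b (i / N) (Fin.ofNat N i)

/-- The measure on `X A` whose consecutive blocks of length `N` are independent of law `P`. -/
noncomputable def blockMeasure (P : Measure (Fin N → A)) : Measure (X A) :=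
  (Measure.infinitePi fun _ : ℕ => P).map (unblock A)

end Blocks

section BlockLemmas

variable {N : ℕ} [NeZero N]

lemma infinitePi_map_shift {B : Type*} [MeasurableSpace B] (P : Measure B)
    [IsProbabilityMeasure P] :
    (Measure.infinitePi fun _ : ℕ => P).map (shift B) = Measure.infinitePi fun _ : ℕ => P := by
  refine Measure.eq_infinitePi _ fun s t ht => ?_
  have hm : Measurable (shift B) := measurable_pi_lambda _ fun n => measurable_pi_apply (n + 1)
  rw [Measure.map_apply hm (MeasurableSet.pi s.countable_toSet fun i _ => ht i)]
  have : shift B ⁻¹' (s : Set ℕ).pi t =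
      ((s.map ⟨Nat.succ, Nat.succ_injective⟩ : Finset ℕ) : Set ℕ).pi fun i => t (i - 1) := by
    ext b
    simp [Set.mem_pi, shift]
  rw [this, Measure.infinitePi_pi _ fun i _ => ht _, Finset.prod_map]
  simp

lemma infinitePi_forall_eq {B : Type*} [MeasurableSpace B] [MeasurableSingletonClass B]
    (P : Measure B) [IsProbabilityMeasure P] (s : Finset ℕ) (c : ℕ → B) :
    (Measure.infinitePi fun _ : ℕ => P).real {b | ∀ i ∈ s, b i = c i} =
      ∏ i ∈ s, P.real {c i} := by
  have : {b : ℕ → B | ∀ i ∈ s, b i = c i} = (s : Set ℕ).pi fun i => {c i} := by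
    ext b
    simp [Set.mem_pi]
  rw [this, measureReal_def, Measure.infinitePi_pi _ fun i _ => measurableSet_singleton _,
    ENNReal.toReal_prod]
  rfl

lemma integral_infinitePi_apply {B : Type*} [MeasurableSpace B] [MeasurableSingletonClass B]
    [Fintype B] (P : Measure B) [IsProbabilityMeasure P] (i : ℕ) (F : B → ℝ) :
    ∫ b, F (b i) ∂(Measure.infinitePi fun _ : ℕ => P) = ∑ w, P.real {w} * F w := by
  have hF : AEStronglyMeasurable F P := (measurable_of_countable F).aestronglyMeasurable
  rw [← integral_map (φ := fun b : ℕ → B => b i) (f := F) (measurable_pi_apply i).aemeasurable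
    (measurable_of_countable F).aestronglyMeasurable,
    Measure.infinitePi_map_eval (fun _ : ℕ => P), integral_fintype (Integrable.of_finite)]
  simp

lemma measurable_unblock : Measurable (unblock A : (ℕ → Fin N → A) → X A) :=
  measurable_pi_lambda _ fun i =>
    (measurable_pi_apply (Fin.ofNat N i)).comp (measurable_pi_apply (i / N))

lemma word_shift_unblock (b : ℕ → Fin N → A) (i : ℕ) :
    word A N ((shift A)^[i * N] (unblock A b)) = b i := by
  have hN := NeZero.pos N
  ext l
  rw [word, shift_iterate_apply, unblock]
  have h1 : (l.val + i * N) / N = i := by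
    rw [Nat.add_mul_div_right _ _ hN, Nat.div_eq_of_lt l.2, zero_add]
  have h2 : Fin.ofNat N (l.val + i * N) = l := by
    ext
    simp [Fin.ofNat, Nat.mod_eq_of_lt l.2]
  rw [h1, h2]

lemma shift_iterate_unblock (b : ℕ → Fin N → A) :
    (shift A)^[N] (unblock A b) = unblock A (shift (Fin N → A) b) := by
  have hN := NeZero.pos N
  ext i
  rw [shift_iterate_apply, unblock, unblock, Nat.add_div_right _ hN]
  have : Fin.ofNat N (i + N) = Fin.ofNat N i := by
    ext
    simp [Fin.ofNat]
  rw [this]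
  rfl

instance (P : Measure (Fin N → A)) [IsProbabilityMeasure P] :
    IsProbabilityMeasure (blockMeasure A P) :=
  Measure.isProbabilityMeasure_map (measurable_unblock A).aemeasurable

lemma blockMeasure_map_shift (P : Measure (Fin N → A)) [IsProbabilityMeasure P] :
    (blockMeasure A P).map ((shift A)^[N]) = blockMeasure A P := by
  have hm : Measurable (shift (Fin N → A)) :=
    measurable_pi_lambda _ fun n => measurable_pi_apply (n + 1)
  rw [blockMeasure, Measure.map_map ((continuous_shift A).iterate N).measurable
    (measurable_unblock A)]
  have : (shift A)^[N] ∘ unblock A = unblock A ∘ shift (Fin N → A) :=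
    funext fun b => shift_iterate_unblock A b
  rw [this, ← Measure.map_map (measurable_unblock A) hm, infinitePi_map_shift]

lemma isProbabilityMeasure_map_shift (μ : Measure (X A)) [IsProbabilityMeasure μ] (j : ℕ) :
    IsProbabilityMeasure (μ.map ((shift A)^[j])) :=
  Measure.isProbabilityMeasure_map ((continuous_shift A).iterate j).measurable.aemeasurable

/-- The shift-invariant average of a measure invariant under the `N`-th iterate of the shift. -/
noncomputable def averageShift (N : ℕ) (μ : Measure (X A)) : Measure (X A) :=
  (N : ENNReal)⁻¹ • ∑ j ∈ Finset.range N, μ.map ((shift A)^[j])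

lemma averageShift_invProb {μ : Measure (X A)} [IsProbabilityMeasure μ]
    (hμ : μ.map ((shift A)^[N]) = μ) : InvProb A (averageShift A N μ) := by
  have hN : (N : ENNReal) ≠ 0 := by simp [NeZero.ne N]
  have hm := (continuous_shift A).measurable
  constructor
  · constructor
    have h (j : ℕ) : (μ.map ((shift A)^[j])) univ = 1 :=
      (isProbabilityMeasure_map_shift A μ j).measure_univ
    simp [averageShift, h, ENNReal.inv_mul_cancel hN]
  · rw [averageShift, Measure.map_smul]
    congr 1
    have h1 (j : ℕ) : (μ.map ((shift A)^[j])).map (shift A) = μ.map ((shift A)^[j + 1]) := by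
      rw [Measure.map_map hm ((continuous_shift A).iterate j).measurable,
        Function.iterate_succ']
    rw [Measure.map_finset_sum hm.aemeasurable]
    simp only [h1]
    obtain ⟨M, rfl⟩ := Nat.exists_eq_succ_of_ne_zero (NeZero.ne N)
    rw [Finset.sum_range_succ, Finset.sum_range_succ', hμ]
    simp

lemma measureReal_averageShift (μ : Measure (X A)) [IsProbabilityMeasure μ] (B : Set (X A)) :
    (averageShift A N μ).real B =
      ∑ j ∈ Finset.range N, (N : ℝ)⁻¹ * (μ.map ((shift A)^[j])).real B := by
  have (j : ℕ) := isProbabilityMeasure_map_shift A μ j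
  rw [← Finset.mul_sum]
  simp [averageShift, measureReal_def, ENNReal.toReal_sum]

lemma integral_averageShift (μ : Measure (X A)) [IsProbabilityMeasure μ] {φ : X A → ℝ}
    (hφc : Continuous φ) :
    N * ∫ x, φ x ∂(averageShift A N μ) = ∫ x, birkhoffSum (shift A) φ N x ∂μ := by
  have (j : ℕ) := isProbabilityMeasure_map_shift A μ j
  have hN : (N : ℝ) ≠ 0 := by simp [NeZero.ne N]
  rw [averageShift, integral_smul_measure,
    integral_finsetSum_measure fun j _ => integrable_of_continuous A hφc _]
  simp only [birkhoffSum]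
  have hi (j : ℕ) : Integrable (fun x => φ ((shift A)^[j] x)) μ :=
    integrable_of_continuous A (hφc.comp ((continuous_shift A).iterate j)) μ
  rw [integral_finsetSum _ fun j _ => hi j]
  simp only [ENNReal.toReal_inv, ENNReal.toReal_natCast, smul_eq_mul]
  rw [mul_inv_cancel_left₀ hN]
  refine Finset.sum_congr rfl fun j _ => ?_
  exact integral_map ((continuous_shift A).iterate j).measurable.aemeasurable
    hφc.aestronglyMeasurable

lemma sum_negMulLog_averageShift (μ : Measure (X A)) [IsProbabilityMeasure μ] (n : ℕ) :
    ∑ j ∈ Finset.range N, (N : ℝ)⁻¹ *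
        ∑ w : Fin n → A, Real.negMulLog ((μ.map ((shift A)^[j])).real (cyl A w)) ≤
      ∑ w : Fin n → A, Real.negMulLog ((averageShift A N μ).real (cyl A w)) := by
  have hN : (N : ℝ) ≠ 0 := by simp [NeZero.ne N]
  simp only [Finset.mul_sum]
  rw [Finset.sum_comm]
  refine Finset.sum_le_sum fun w _ => ?_
  rw [measureReal_averageShift]
  have := Real.concaveOn_negMulLog.le_map_sum (t := Finset.range N) (w := fun _ => (N : ℝ)⁻¹)
    (p := fun j => (μ.map ((shift A)^[j])).real (cyl A w)) (fun _ _ => by positivity)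
    (by simp [hN]) (fun _ _ => measureReal_nonneg)
  simpa using this

lemma blockMeasure_entropy_bound [Nonempty A] (P : Measure (Fin N → A)) [IsProbabilityMeasure P]
    {j k n : ℕ} (hj : j < N) (hk : (k + 1) * N ≤ n) :
    k * ∑ w, Real.negMulLog (P.real {w}) ≤
      ∑ w : Fin n → A, Real.negMulLog (((blockMeasure A P).map ((shift A)^[j])).real (cyl A w)) := by
  have hN := NeZero.pos N
  set ρ := Measure.infinitePi fun _ : ℕ => P with hρ
  set κ := (blockMeasure A P).map ((shift A)^[j]) with hκ
  have hκp : IsProbabilityMeasure κ := isProbabilityMeasure_map_shift A _ j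
  have hm : Measurable fun b : ℕ → Fin N → A => (shift A)^[j] (unblock A b) :=
    ((continuous_shift A).iterate j).measurable.comp (measurable_unblock A)
  have hκ' : κ = ρ.map fun b => (shift A)^[j] (unblock A b) := by
    rw [hκ, blockMeasure, Measure.map_map ((continuous_shift A).iterate j).measurable
      (measurable_unblock A)]
    rfl
  let x₀ : X A := Classical.arbitrary _
  let blk : (Fin n → A) → ℕ → Fin N → A :=
    fun w i => word A N ((shift A)^[i * N - j] (glue A w x₀))
  have hblk (b : ℕ → Fin N → A) (w : Fin n → A) (hw : (shift A)^[j] (unblock A b) ∈ cyl A w)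
      (i : ℕ) (hi : i ∈ Finset.Icc 1 k) : b i = blk w i := by
    rw [Finset.mem_Icc] at hi
    have h1 : N ≤ i * N := Nat.le_mul_of_pos_left N hi.1
    have h2 : (i + 1) * N ≤ (k + 1) * N := Nat.mul_le_mul_right N (by omega)
    rw [← word_shift_unblock A b i]
    ext l
    have hl := l.2
    have h3 : l.val + (i * N - j) < n := by
      rw [add_mul, one_mul] at h2
      omega
    have h4 := hw ⟨_, h3⟩
    simp only [shift_iterate_apply] at h4
    simp only [blk, word, shift_iterate_apply, glue, h3, dif_pos, ← h4]
    congr 1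
    omega
  let F : (Fin n → A) → ℝ := fun w => ∑ i ∈ Finset.Icc 1 k, -Real.log (P.real {blk w i})
  have hF : k * ∑ w, Real.negMulLog (P.real {w}) = ∑ w, κ.real (cyl A w) * F w := by
    have h1 : (fun b => F (word A n ((shift A)^[j] (unblock A b)))) =
        fun b : ℕ → Fin N → A => ∑ i ∈ Finset.Icc 1 k, -Real.log (P.real {b i}) := by
      ext b
      refine Finset.sum_congr rfl fun i hi => ?_
      rw [← hblk b _ (mem_cyl_word A n _) i hi]
    have hFm : Measurable fun x => F (word A n x) :=
      (measurable_of_countable F).comp (measurable_word A n)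
    rw [← integral_word, hκ', integral_map hm.aemeasurable hFm.aestronglyMeasurable, h1,
      integral_finsetSum]
    · have h2 (i : ℕ) := integral_infinitePi_apply P i fun w => -Real.log (P.real {w})
      simp only [hρ, h2, Finset.sum_const, Nat.card_Icc, add_tsub_cancel_right, nsmul_eq_mul,
        Real.negMulLog, mul_neg, neg_mul]
    · intro i _
      have : Integrable (fun w : Fin N → A => -Real.log (P.real {w})) (ρ.map fun b => b i) := by
        rw [hρ, Measure.infinitePi_map_eval (fun _ : ℕ => P)]
        exact Integrable.of_finite
      exact this.comp_measurable (measurable_pi_apply i)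
  rw [hF]
  refine Finset.sum_le_sum fun w _ => ?_
  rcases (measureReal_nonneg (μ := κ) (s := cyl A w)).eq_or_lt with h0 | h0
  · simp [← h0]
  rw [Real.negMulLog, neg_mul, ← mul_neg]
  refine mul_le_mul_of_nonneg_left ?_ h0.le
  have hle : κ.real (cyl A w) ≤ ∏ i ∈ Finset.Icc 1 k, P.real {blk w i} := by
    rw [← infinitePi_forall_eq, hκ', map_measureReal_apply hm (measurableSet_cyl A w)]
    exact measureReal_mono fun b hb i hi => hblk b w hb i hi
  have hpos := h0.trans_le hle
  have hne : ∀ i ∈ Finset.Icc 1 k, P.real {blk w i} ≠ 0 := fun i hi =>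
    Finset.prod_ne_zero_iff.1 hpos.ne' i hi
  simp only [F, Finset.sum_neg_distrib]
  rw [← Real.log_prod hne]
  exact neg_le_neg (Real.log_le_log h0 hle)

lemma le_entropy_averageShift [Nonempty A] (P : Measure (Fin N → A)) [IsProbabilityMeasure P] :
    ∑ w, Real.negMulLog (P.real {w}) ≤ N * entropy A (averageShift A N (blockMeasure A P)) := by
  have hN := NeZero.pos N
  have hN' : (0 : ℝ) < N := by exact_mod_cast hN
  have := (averageShift_invProb A (blockMeasure_map_shift A P)).1
  set H := ∑ w, Real.negMulLog (P.real {w}) with hH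
  have hH0 : 0 ≤ H := Finset.sum_nonneg fun w _ =>
    Real.negMulLog_nonneg measureReal_nonneg measureReal_le_one
  rw [← div_le_iff₀' hN']
  have hlim : Tendsto (fun n : ℕ => H / N - 2 * H / n) atTop (𝓝 (H / N - 0)) :=
    tendsto_const_nhds.sub (tendsto_const_div_atTop_nhds_zero_nat _)
  rw [sub_zero] at hlim
  refine le_entropy_of_tendsto A _ hlim ?_
  filter_upwards [eventually_ge_atTop N] with n hn
  have hn0 : (0 : ℝ) < n := by exact_mod_cast hN.trans_le hn
  have hdiv : 1 ≤ n / N := (Nat.one_le_div_iff hN).2 hn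
  have hk : (n / N - 1 + 1) * N ≤ n := by
    rw [Nat.sub_add_cancel hdiv]
    exact Nat.div_mul_le_self n N
  have h1 : ((n / N - 1 : ℕ) : ℝ) * H ≤ ∑ w : Fin n → A,
      Real.negMulLog ((averageShift A N (blockMeasure A P)).real (cyl A w)) := by
    refine le_trans ?_ (sum_negMulLog_averageShift A _ n)
    rw [← Finset.mul_sum, ← div_eq_inv_mul, le_div_iff₀' hN']
    have := Finset.sum_le_sum fun j (hj : j ∈ Finset.range N) =>
      blockMeasure_entropy_bound A P (Finset.mem_range.1 hj) hk
    simpa using this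
  have h2 : (n : ℝ) / N - 2 ≤ ((n / N - 1 : ℕ) : ℝ) := by
    have h3 : (n : ℝ) / N < ((n / N : ℕ) : ℝ) + 1 := by
      rw [div_lt_iff₀ hN']
      exact_mod_cast Nat.lt_mul_of_div_lt (Nat.lt_succ_self _) hN
    push_cast [hdiv]
    linarith
  rw [entSeq_eq, one_div, ← div_eq_inv_mul, le_div_iff₀ hn0]
  calc (H / N - 2 * H / n) * n = (n / N - 2) * H := by field_simp
    _ ≤ _ := (mul_le_mul_of_nonneg_right h2 hH0).trans h1

end BlockLemmas

/-! ### Pressure and partition functions -/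

/-- The partition function `∑ μ(a_1^n)^s`. -/
noncomputable def partition (μ : Measure (X A)) (n : ℕ) (s : ℝ) : ℝ :=
  ∑ w : Fin n → A, Real.exp (s * Real.log (μ.real (cyl A w)))

lemma partition_pos [Nonempty A] (μ : Measure (X A)) (n : ℕ) (s : ℝ) : 0 < partition A μ n s :=
  Finset.sum_pos (fun _ _ => Real.exp_pos _) Finset.univ_nonempty

section Gibbs

variable {A} {φ : X A → ℝ} {μ : Measure (X A)} {C : ℝ} [IsProbabilityMeasure μ] [Nonempty A]

lemma QuasiGibbs.measureReal_cyl_le (hG : QuasiGibbs A φ μ C) {n : ℕ} {w : Fin n → A} {x : X A}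
    (hx : x ∈ cyl A w) : μ.real (cyl A w) ≤ Real.exp (birkhoffSum (shift A) φ n x + C) := by
  simpa using hG.upper w hx MeasurableSet.univ

lemma QuasiGibbs.le_measureReal_cyl (hG : QuasiGibbs A φ μ C) {n : ℕ} {w : Fin n → A} {x : X A}
    (hx : x ∈ cyl A w) : Real.exp (birkhoffSum (shift A) φ n x - C) ≤ μ.real (cyl A w) := by
  simpa using hG.lower w hx MeasurableSet.univ

lemma QuasiGibbs.cyl_pos (hG : QuasiGibbs A φ μ C) {n : ℕ} (w : Fin n → A) :
    0 < μ.real (cyl A w) := by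
  obtain ⟨x, hx⟩ := cyl_nonempty A w
  exact (Real.exp_pos _).trans_le (hG.le_measureReal_cyl hx)

lemma QuasiGibbs.abs_sub_log_le (hG : QuasiGibbs A φ μ C) {n : ℕ} {w : Fin n → A} {x : X A}
    (hx : x ∈ cyl A w) :
    |birkhoffSum (shift A) φ n x - Real.log (μ.real (cyl A w))| ≤ C := by
  have h1 := (Real.le_log_iff_exp_le (hG.cyl_pos w)).2 (hG.le_measureReal_cyl hx)
  have h2 := (Real.log_le_iff_le_exp (hG.cyl_pos w)).2 (hG.measureReal_cyl_le hx)
  exact abs_le.2 ⟨by linarith, by linarith⟩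

lemma continuous_birkhoffSum (hφc : Continuous φ) (n : ℕ) :
    Continuous fun x => birkhoffSum (shift A) φ n x := by
  simp only [birkhoffSum]
  exact continuous_finsetSum _ fun j _ => hφc.comp ((continuous_shift A).iterate j)

lemma QuasiGibbs.abs_integral_sub_le (hG : QuasiGibbs A φ μ C) (hφc : Continuous φ)
    (ξ : Measure (X A)) [IsProbabilityMeasure ξ] (n : ℕ) :
    |∫ x, birkhoffSum (shift A) φ n x ∂ξ -
      ∑ w : Fin n → A, ξ.real (cyl A w) * Real.log (μ.real (cyl A w))| ≤ C := by
  have hi : Integrable (fun x => Real.log (μ.real (cyl A (word A n x)))) ξ := by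
    have : Integrable (fun w : Fin n → A => Real.log (μ.real (cyl A w))) (ξ.map (word A n)) :=
      Integrable.of_finite
    exact this.comp_measurable (measurable_word A n)
  rw [← integral_word A ξ n fun w => Real.log (μ.real (cyl A w)),
    ← integral_sub (integrable_of_continuous A (continuous_birkhoffSum hφc n) ξ) hi]
  have := norm_integral_le_of_norm_le_const (μ := ξ) (C := C)
    (f := fun x => birkhoffSum (shift A) φ n x - Real.log (μ.real (cyl A (word A n x))))
    (Eventually.of_forall fun x => hG.abs_sub_log_le (mem_cyl_word A n x))
  simpa using this

lemma InvProb.measurePreserving {ξ : Measure (X A)} (hξ : InvProb A ξ) :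
    MeasurePreserving (shift A) ξ ξ := ⟨(continuous_shift A).measurable, hξ.2⟩

lemma integral_birkhoffSum (hφc : Continuous φ) {ξ : Measure (X A)} (hξ : InvProb A ξ) (n : ℕ) :
    ∫ x, birkhoffSum (shift A) φ n x ∂ξ = n * ∫ x, φ x ∂ξ := by
  have := hξ.1
  have hi (j : ℕ) : Integrable (fun x => φ ((shift A)^[j] x)) ξ :=
    integrable_of_continuous A (hφc.comp ((continuous_shift A).iterate j)) ξ
  simp only [birkhoffSum]
  rw [integral_finsetSum _ fun j _ => hi j]
  have h (j : ℕ) : ∫ x, φ ((shift A)^[j] x) ∂ξ = ∫ x, φ x ∂ξ := by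
    have hp := hξ.measurePreserving.iterate j
    conv_rhs => rw [← hp.map_eq]
    exact (integral_map hp.measurable.aemeasurable hφc.aestronglyMeasurable).symm
  simp [h]

lemma QuasiGibbs.abs_mul_integral_sub_le (hG : QuasiGibbs A φ μ C) (hφc : Continuous φ)
    {ξ : Measure (X A)} (hξ : InvProb A ξ) (n : ℕ) :
    |n * ∫ x, φ x ∂ξ -
      ∑ w : Fin n → A, ξ.real (cyl A w) * Real.log (μ.real (cyl A w))| ≤ C := by
  have := hξ.1
  rw [← integral_birkhoffSum hφc hξ]
  exact hG.abs_integral_sub_le hφc ξ n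

lemma exists_measure_singleton {B : Type*} [Fintype B] [MeasurableSpace B]
    [MeasurableSingletonClass B] {p : B → ℝ} (hp : ∀ w, 0 ≤ p w) (hsum : ∑ w, p w = 1) :
    ∃ P : Measure B, IsProbabilityMeasure P ∧ ∀ w, P.real {w} = p w := by
  classical
  refine ⟨∑ w, ENNReal.ofReal (p w) • Measure.dirac w, ⟨?_⟩, fun v => ?_⟩
  · simp [← ENNReal.ofReal_sum_of_nonneg fun w _ => hp w, hsum]
  · rw [measureReal_def, Measure.finsetSum_apply, Finset.sum_eq_single v]
    · simp [hp v]
    · intro w _ hw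
      simp [hw]
    · simp

lemma blockMeasure_real_cyl {N : ℕ} [NeZero N] (P : Measure (Fin N → A)) [IsProbabilityMeasure P]
    (w : Fin N → A) : (blockMeasure A P).real (cyl A w) = P.real {w} := by
  rw [blockMeasure, map_measureReal_apply (measurable_unblock A) (measurableSet_cyl A w)]
  have h : unblock A ⁻¹' cyl A w = {b : ℕ → Fin N → A | ∀ i ∈ ({0} : Finset ℕ), b i = w} := by
    ext b
    have := word_shift_unblock A b 0
    simp only [zero_mul, Function.iterate_zero, id] at this
    rw [← word_preimage_singleton]
    simp [this]
  rw [h, infinitePi_forall_eq P {0} fun _ => w]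
  simp

lemma QuasiGibbs.exists_invProb (hG : QuasiGibbs A φ μ C) (hφc : Continuous φ)
    {N : ℕ} [NeZero N] {p : (Fin N → A) → ℝ} (hp : ∀ w, 0 ≤ p w) (hsum : ∑ w, p w = 1) :
    ∃ η, InvProb A η ∧ ∑ w, Real.negMulLog (p w) ≤ N * entropy A η ∧
      |N * ∫ x, φ x ∂η - ∑ w, p w * Real.log (μ.real (cyl A w))| ≤ C := by
  obtain ⟨P, hP, hPp⟩ := exists_measure_singleton hp hsum
  refine ⟨_, averageShift_invProb A (blockMeasure_map_shift A P), ?_, ?_⟩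
  · simpa [hPp] using le_entropy_averageShift A P
  · rw [integral_averageShift A _ hφc]
    simpa [blockMeasure_real_cyl, hPp] using hG.abs_integral_sub_le hφc (blockMeasure A P) N

/-- The normalised weights `μ(a_1^N)^s / ∑ μ(b_1^N)^s`. -/
noncomputable def tiltedWeight (μ : Measure (X A)) (N : ℕ) (s : ℝ) (w : Fin N → A) : ℝ :=
  Real.exp (s * Real.log (μ.real (cyl A w))) / partition A μ N s

lemma tiltedWeight_pos (N : ℕ) (s : ℝ) (w : Fin N → A) : 0 < tiltedWeight μ N s w :=
  div_pos (Real.exp_pos _) (partition_pos A μ N s)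

lemma sum_tiltedWeight (N : ℕ) (s : ℝ) : ∑ w, tiltedWeight μ N s w = 1 := by
  simp only [tiltedWeight]
  rw [← Finset.sum_div]
  exact div_self (partition_pos A μ N s).ne'

lemma log_tiltedWeight (N : ℕ) (s : ℝ) (w : Fin N → A) :
    Real.log (tiltedWeight μ N s w) =
      s * Real.log (μ.real (cyl A w)) - Real.log (partition A μ N s) := by
  rw [tiltedWeight, Real.log_div (Real.exp_pos _).ne' (partition_pos A μ N s).ne', Real.log_exp]

lemma abs_mul_sub_le {s a b c : ℝ} (h : |a - b| ≤ c) : |s * a - s * b| ≤ |s| * c := by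
  rw [← mul_sub, abs_mul]
  exact mul_le_mul_of_nonneg_left h (abs_nonneg s)

lemma QuasiGibbs.exists_le_pressure_term (hG : QuasiGibbs A φ μ C) (hφc : Continuous φ)
    {N : ℕ} (hN : 0 < N) (s : ℝ) :
    ∃ η, InvProb A η ∧
      Real.log (partition A μ N s) - |s| * C ≤ N * (entropy A η + s * ∫ x, φ x ∂η) := by
  have : NeZero N := ⟨hN.ne'⟩
  obtain ⟨η, hη, h1, h2⟩ := hG.exists_invProb hφc (p := tiltedWeight μ N s)
    (fun w => (tiltedWeight_pos N s w).le) (sum_tiltedWeight N s)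
  refine ⟨η, hη, ?_⟩
  have h3 : ∑ w, Real.negMulLog (tiltedWeight μ N s w) = Real.log (partition A μ N s) -
      s * ∑ w, tiltedWeight μ N s w * Real.log (μ.real (cyl A w)) := by
    simp only [Real.negMulLog, log_tiltedWeight]
    have h4 (w : Fin N → A) : -tiltedWeight μ N s w *
        (s * Real.log (μ.real (cyl A w)) - Real.log (partition A μ N s)) =
        tiltedWeight μ N s w * Real.log (partition A μ N s) -
          s * (tiltedWeight μ N s w * Real.log (μ.real (cyl A w))) := by ring
    simp only [h4]
    rw [Finset.sum_sub_distrib, ← Finset.sum_mul, sum_tiltedWeight, one_mul, Finset.mul_sum]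
  have h5 := (abs_le.1 (abs_mul_sub_le (s := s) h2)).1
  linarith

lemma QuasiGibbs.log_measureReal_cyl_le (hG : QuasiGibbs A φ μ C) (hφc : Continuous φ)
    {N : ℕ} (hN : 0 < N) (w : Fin N → A) :
    Real.log (μ.real (cyl A w)) ≤ N * supInt A φ + C := by
  classical
  have : NeZero N := ⟨hN.ne'⟩
  obtain ⟨η, hη, -, h2⟩ := hG.exists_invProb hφc (p := Pi.single w 1)
    (fun v => by by_cases h : v = w <;> simp [h]) (by simp)
  have hN' : (0 : ℝ) ≤ N := by positivity
  obtain ⟨M, -, hM⟩ := exists_abs_le_of_continuous A hφc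
  have h3 : ∫ x, φ x ∂η ≤ supInt A φ := by
    refine le_csSup ⟨M, ?_⟩ ⟨η, hη, rfl⟩
    rintro r ⟨ξ, hξ, rfl⟩
    have := hξ.1
    simpa using integral_mono (integrable_of_continuous A hφc ξ) (integrable_const M)
      fun x => (abs_le.1 (hM x)).2
  have h4 := mul_le_mul_of_nonneg_left h3 hN'
  have h5 := (abs_le.1 h2).1
  simp [Pi.single_apply] at h5
  linarith

lemma blockMeasure_real_cyl_mul {N : ℕ} [NeZero N] (P : Measure (Fin N → A))
    [IsProbabilityMeasure P] (k : ℕ) (w : Fin (k * N) → A) {x : X A} (hx : x ∈ cyl A w) :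
    ∏ i ∈ Finset.range k, P.real {word A N ((shift A)^[i * N] x)} ≤
      (blockMeasure A P).real (cyl A w) := by
  have hN := NeZero.pos N
  rw [blockMeasure, map_measureReal_apply (measurable_unblock A) (measurableSet_cyl A w),
    ← infinitePi_forall_eq]
  refine measureReal_mono fun b hb i => ?_
  have h1 : i.val / N < k := (Nat.div_lt_iff_lt_mul hN).2 i.2
  have h2 := congrFun (hb (i.val / N) (Finset.mem_range.2 h1)) (Fin.ofNat N i)
  rw [unblock, h2, ← hx i, word, shift_iterate_apply]
  congr 1
  exact Nat.mod_add_div' _ _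

lemma QuasiGibbs.pressure_term_le (hG : QuasiGibbs A φ μ C) (hφc : Continuous φ)
    {N : ℕ} (hN : 0 < N) (s : ℝ) {ξ : Measure (X A)} (hξ : InvProb A ξ) :
    N * (entropy A ξ + s * ∫ x, φ x ∂ξ) ≤ Real.log (partition A μ N s) + |s| * C := by
  have : NeZero N := ⟨hN.ne'⟩
  have hN' : (0 : ℝ) < N := by exact_mod_cast hN
  have := hξ.1
  obtain ⟨P, hP, hPp⟩ := exists_measure_singleton (p := tiltedWeight μ N s)
    (fun w => (tiltedWeight_pos N s w).le) (sum_tiltedWeight N s)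
  set G := ∑ w : Fin N → A, ξ.real (cyl A w) * Real.log (μ.real (cyl A w)) with hGdef
  set Z := Real.log (partition A μ N s) with hZ
  have hmain (k : ℕ) : ∑ w : Fin (k * N) → A, Real.negMulLog (ξ.real (cyl A w)) ≤
      k * (Z - s * G) := by
    let x₀ : X A := Classical.arbitrary _
    let F : (Fin (k * N) → A) → ℝ := fun w => ∑ i ∈ Finset.range k,
      Real.log (tiltedWeight μ N s (word A N ((shift A)^[i * N] (glue A w x₀))))
    have hprod (w : Fin (k * N) → A) : 0 < ∏ i ∈ Finset.range k,
        P.real {word A N ((shift A)^[i * N] (glue A w x₀))} :=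
      Finset.prod_pos fun i _ => by rw [hPp]; exact tiltedWeight_pos N s _
    have hle (w : Fin (k * N) → A) := blockMeasure_real_cyl_mul P k w (glue_mem_cyl A w x₀)
    have h1 := sum_negMulLog_le (p := fun w : Fin (k * N) → A => ξ.real (cyl A w))
      (q := fun w => (blockMeasure A P).real (cyl A w)) (fun _ => measureReal_nonneg)
      (fun w => (hprod w).trans_le (hle w))
      (by rw [sum_measureReal_cyl, sum_measureReal_cyl])
    have h2 (w : Fin (k * N) → A) : F w ≤ Real.log ((blockMeasure A P).real (cyl A w)) := by
      have h3 := Real.log_le_log (hprod w) (hle w)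
      rw [Real.log_prod fun i _ => by rw [hPp]; exact (tiltedWeight_pos N s _).ne'] at h3
      simpa only [hPp] using h3
    have h4 : ∑ w, ξ.real (cyl A w) * F w = k * (s * G - Z) := by
      have h5 : (fun x => F (word A (k * N) x)) = fun x => ∑ i ∈ Finset.range k,
          Real.log (tiltedWeight μ N s (word A N ((shift A)^[i * N] x))) := by
        ext x
        refine Finset.sum_congr rfl fun i hi => ?_
        congr 2
        ext l
        have hi' := Finset.mem_range.1 hi
        have h6 : l.val + i * N < k * N :=
          calc l.val + i * N < N + i * N := by have := l.2; omega
            _ = (i + 1) * N := by ring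
            _ ≤ k * N := Nat.mul_le_mul_right N hi'
        simp only [word, shift_iterate_apply, glue, h6, dif_pos]
      have hlm : Measurable fun w : Fin N → A => Real.log (tiltedWeight μ N s w) :=
        measurable_of_countable _
      have h7 (i : ℕ) : Integrable
          (fun x => Real.log (tiltedWeight μ N s (word A N ((shift A)^[i * N] x)))) ξ ∧
          ∫ x, Real.log (tiltedWeight μ N s (word A N ((shift A)^[i * N] x))) ∂ξ =
            s * G - Z := by
        have hp := hξ.measurePreserving.iterate (i * N)
        have hi : Integrable (fun x => Real.log (tiltedWeight μ N s (word A N x))) ξ := by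
          have : Integrable (fun w : Fin N → A => Real.log (tiltedWeight μ N s w))
            (ξ.map (word A N)) := Integrable.of_finite
          exact this.comp_measurable (measurable_word A N)
        refine ⟨hp.integrable_comp_of_integrable hi, ?_⟩
        have h8 := integral_map (μ := ξ) hp.measurable.aemeasurable
          (f := fun x => Real.log (tiltedWeight μ N s (word A N x)))
          (hlm.comp (measurable_word A N)).aestronglyMeasurable
        rw [← h8, hp.map_eq, integral_word A ξ N fun w => Real.log (tiltedWeight μ N s w)]
        simp only [log_tiltedWeight, mul_sub, Finset.sum_sub_distrib, ← Finset.sum_mul,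
          sum_measureReal_cyl, one_mul, hGdef, Finset.mul_sum]
        congr 1
        exact Finset.sum_congr rfl fun w _ => by ring
      rw [← integral_word, h5, integral_finsetSum _ fun i _ => (h7 i).1]
      simp only [(h7 _).2, Finset.sum_const, Finset.card_range, nsmul_eq_mul]
    calc _ ≤ _ := h1
      _ ≤ ∑ w, ξ.real (cyl A w) * -F w := Finset.sum_le_sum fun w _ =>
          mul_le_mul_of_nonneg_left (neg_le_neg (h2 w)) measureReal_nonneg
      _ = k * (Z - s * G) := by
          simp only [mul_neg, Finset.sum_neg_distrib, h4]
          ring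
  have hent : entropy A ξ ≤ (Z - s * G) / N := by
    refine entropy_le_of_frequently A ξ (frequently_atTop.2 fun m => ?_)
    refine ⟨(m + 1) * N, ?_, ?_⟩
    · exact (Nat.le_succ m).trans (Nat.le_mul_of_pos_right _ hN)
    · have hm : (0 : ℝ) < ((m + 1 : ℕ) : ℝ) := by positivity
      have h1 := hmain (m + 1)
      rw [entSeq_eq, one_div, Nat.cast_mul, inv_mul_le_iff₀ (mul_pos hm hN')]
      refine h1.trans_eq ?_
      field_simp
  rw [le_div_iff₀' hN'] at hent
  have h5 := (abs_le.1 (abs_mul_sub_le (s := s) (hG.abs_mul_integral_sub_le hφc hξ N))).2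
  linarith

lemma QuasiGibbs.pressure_bddAbove (hG : QuasiGibbs A φ μ C) (hφc : Continuous φ) (s : ℝ) :
    BddAbove {r | ∃ η : Measure (X A), InvProb A η ∧
      r = entropy A η + ∫ x, s * φ x ∂η} := by
  refine ⟨Real.log (partition A μ 1 s) + |s| * C, ?_⟩
  rintro r ⟨η, hη, rfl⟩
  simpa [integral_const_mul] using hG.pressure_term_le hφc one_pos s hη

lemma QuasiGibbs.le_pressure (hG : QuasiGibbs A φ μ C) (hφc : Continuous φ) (s : ℝ)
    {η : Measure (X A)} (hη : InvProb A η) :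
    entropy A η + s * ∫ x, φ x ∂η ≤ pressure A fun x => s * φ x :=
  le_csSup (hG.pressure_bddAbove hφc s) ⟨η, hη, by rw [integral_const_mul]⟩

lemma QuasiGibbs.mul_pressure_le (hG : QuasiGibbs A φ μ C) (hφc : Continuous φ)
    {N : ℕ} (hN : 0 < N) (s : ℝ) :
    N * pressure A (fun x => s * φ x) ≤ Real.log (partition A μ N s) + |s| * C := by
  have hN' : (0 : ℝ) < N := by exact_mod_cast hN
  obtain ⟨η₀, hη₀, -⟩ := hG.exists_le_pressure_term hφc hN s
  rw [← le_div_iff₀' hN']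
  refine csSup_le ⟨_, η₀, hη₀, rfl⟩ ?_
  rintro r ⟨η, hη, rfl⟩
  rw [integral_const_mul, le_div_iff₀' hN']
  exact hG.pressure_term_le hφc hN s hη

lemma QuasiGibbs.log_partition_le (hG : QuasiGibbs A φ μ C) (hφc : Continuous φ)
    {N : ℕ} (hN : 0 < N) (s : ℝ) :
    Real.log (partition A μ N s) ≤ N * pressure A (fun x => s * φ x) + |s| * C := by
  obtain ⟨η, hη, h⟩ := hG.exists_le_pressure_term hφc hN s
  have := mul_le_mul_of_nonneg_left (hG.le_pressure hφc s hη) (Nat.cast_nonneg (α := ℝ) N)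
  linarith

lemma QuasiGibbs.partition_one (hG : QuasiGibbs A φ μ C) (n : ℕ) : partition A μ n 1 = 1 := by
  refine (Finset.sum_congr rfl fun w _ => ?_).trans (sum_measureReal_cyl A μ n)
  rw [one_mul, Real.exp_log (hG.cyl_pos w)]

lemma eq_zero_of_mul_le {a c : ℝ} (h : ∀ n : ℕ, 0 < n → |n * a| ≤ c) : a = 0 := by
  by_contra ha
  obtain ⟨n, hn⟩ := exists_nat_gt (c / |a|)
  have ha' : 0 < |a| := abs_pos.2 ha
  rw [div_lt_iff₀ ha'] at hn
  have h1 := h (n + 1) n.succ_pos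
  rw [abs_mul, Nat.abs_cast] at h1
  push_cast at h1
  linarith

lemma QuasiGibbs.pressure_one (hG : QuasiGibbs A φ μ C) (hφc : Continuous φ) :
    pressure A (fun x => 1 * φ x) = 0 := by
  refine eq_zero_of_mul_le (c := C) fun n hn => abs_le.2 ⟨?_, ?_⟩
  · have := hG.log_partition_le hφc hn 1
    rw [hG.partition_one, Real.log_one, abs_one] at this
    linarith
  · have := hG.mul_pressure_le hφc hn 1
    rw [hG.partition_one, Real.log_one, abs_one] at this
    linarith

lemma QuasiGibbs.entropy_eq (hG : QuasiGibbs A φ μ C) (hφc : Continuous φ)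
    (hinv : InvProb A μ) : entropy A μ = -∫ x, φ x ∂μ := by
  refine Tendsto.liminf_eq ?_
  rw [tendsto_iff_norm_sub_tendsto_zero]
  refine squeeze_zero' (Eventually.of_forall fun _ => norm_nonneg _) ?_
    (tendsto_const_div_atTop_nhds_zero_nat C)
  filter_upwards [eventually_gt_atTop 0] with n hn
  have hn' : (0 : ℝ) < n := by exact_mod_cast hn
  rw [le_div_iff₀ hn', ← Nat.abs_cast n, Real.norm_eq_abs, ← abs_mul]
  have e : (entSeq A μ n - -∫ x, φ x ∂μ) * n =
      n * ∫ x, φ x ∂μ - ∑ w : Fin n → A, μ.real (cyl A w) * Real.log (μ.real (cyl A w)) := by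
    rw [entSeq_eq]
    simp only [Real.negMulLog, neg_mul, Finset.sum_neg_distrib]
    field_simp
    ring
  rw [e]
  exact hG.abs_mul_integral_sub_le hφc hinv n

lemma QuasiGibbs.entropy_le_log_card (hG : QuasiGibbs A φ μ C) (hφc : Continuous φ)
    {ξ : Measure (X A)} (hξ : InvProb A ξ) : entropy A ξ ≤ Real.log (Fintype.card A) := by
  simpa [partition] using hG.pressure_term_le hφc one_pos 0 hξ

end Gibbs

/-! ### Strictness of the infimum of the integrals -/

lemma sum_smul_map_prepend_infinitePi (P : Measure A) [IsProbabilityMeasure P] :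
    ∑ a, P {a} • (Measure.infinitePi fun _ : ℕ => P).map (prepend A a) =
      Measure.infinitePi fun _ : ℕ => P := by
  classical
  refine Measure.eq_infinitePi _ fun s t ht => ?_
  set s' : Finset ℕ := s.preimage Nat.succ (Nat.succ_injective.injOn) with hs'
  have hpre (a : A) : prepend A a ⁻¹' (s : Set ℕ).pi t =
      if 0 ∈ s → a ∈ t 0 then (s' : Set ℕ).pi fun i => t (i + 1) else ∅ := by
    have h (x : X A) : prepend A a x ∈ (s : Set ℕ).pi t ↔
        (0 ∈ s → a ∈ t 0) ∧ x ∈ (s' : Set ℕ).pi fun i => t (i + 1) := by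
      simp only [Set.mem_pi, Finset.mem_coe, hs', Finset.mem_preimage]
      refine ⟨fun H => ⟨H 0, fun i hi => H _ hi⟩, fun H i hi => ?_⟩
      cases i with
      | zero => exact H.1 hi
      | succ i => exact H.2 i hi
    ext x
    rw [Set.mem_preimage, h]
    by_cases h0 : 0 ∈ s → a ∈ t 0
    · rw [if_pos h0]
      exact and_iff_right h0
    · rw [if_neg h0]
      exact iff_of_false (fun H => h0 H.1) (Set.notMem_empty x)
  have hval (a : A) : (Measure.infinitePi fun _ : ℕ => P).map (prepend A a) ((s : Set ℕ).pi t) =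
      if 0 ∈ s → a ∈ t 0 then ∏ i ∈ s', P (t (i + 1)) else 0 := by
    rw [Measure.map_apply (continuous_prepend A a).measurable
      (MeasurableSet.pi s.countable_toSet fun i _ => ht i), hpre]
    split_ifs with h0
    · exact Measure.infinitePi_pi _ fun i _ => ht _
    · simp
  have hsum (S : Set A) : ∑ a, (if a ∈ S then P {a} else 0) = P S := by
    rw [← Finset.sum_filter, sum_measure_singleton]
    simp
  have herase : ∏ i ∈ s.erase 0, P (t i) = ∏ i ∈ s', P (t (i + 1)) := by
    have : s.erase 0 = s'.map ⟨Nat.succ, Nat.succ_injective⟩ := by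
      ext i
      cases i with
      | zero => simp
      | succ i => simp [hs']
    rw [this, Finset.prod_map]
    rfl
  rw [Measure.finsetSum_apply]
  simp only [Measure.smul_apply, hval, smul_eq_mul, mul_ite, mul_zero]
  by_cases h0 : 0 ∈ s
  · rw [← Finset.mul_prod_erase s _ h0, herase, ← hsum (t 0), Finset.sum_mul]
    simp [h0]
  · rw [← Finset.erase_eq_of_notMem h0, herase]
    have h1 : ∑ a, P {a} = 1 := by simpa only [Set.mem_univ, if_true, measure_univ] using hsum univ
    simp [h0, ← Finset.sum_mul, h1]

lemma integral_infinitePi_eq_sum_prepend (P : Measure A) [IsProbabilityMeasure P] {f : X A → ℝ}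
    (hf : Continuous f) :
    ∫ x, f x ∂(Measure.infinitePi fun _ : ℕ => P) =
      ∑ a, P.real {a} * ∫ x, f (prepend A a x) ∂(Measure.infinitePi fun _ : ℕ => P) := by
  conv_lhs => rw [← sum_smul_map_prepend_infinitePi A P]
  rw [integral_finsetSum_measure fun a _ => ?_]
  · refine Finset.sum_congr rfl fun a _ => ?_
    rw [integral_smul_measure, integral_map (continuous_prepend A a).measurable.aemeasurable
      hf.aestronglyMeasurable]
    rfl
  · have : IsProbabilityMeasure ((Measure.infinitePi fun _ : ℕ => P).map (prepend A a)) :=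
      Measure.isProbabilityMeasure_map (continuous_prepend A a).measurable.aemeasurable
    exact (integrable_of_continuous A hf _).smul_measure (by simp)

lemma isOpenPosMeasure_infinitePi (P : Measure A) [IsProbabilityMeasure P]
    (hP : ∀ a, P {a} ≠ 0) : (Measure.infinitePi fun _ : ℕ => P).IsOpenPosMeasure := by
  refine ⟨fun U hU ⟨x, hx⟩ h0 => ?_⟩
  obtain ⟨s, t, ht, hsub⟩ := isOpen_pi_iff.1 hU x hx
  have h1 := measure_mono_null hsub h0
  rw [Measure.infinitePi_pi _ fun i _ => (Set.toFinite (t i)).measurableSet,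
    Finset.prod_eq_zero_iff] at h1
  obtain ⟨i, hi, h2⟩ := h1
  exact hP (x i) (measure_mono_null (Set.singleton_subset_iff.2 (ht i hi).2) h2)

lemma exists_integral_lt_neg_log_card [Nonempty A] {φ : X A → ℝ} (hφc : Continuous φ)
    (hnorm : Normalized A φ) (hne : ∃ x, φ x ≠ -Real.log (Fintype.card A)) :
    ∃ η, InvProb A η ∧ ∫ x, φ x ∂η < -Real.log (Fintype.card A) := by
  have hk : (0 : ℝ) < Fintype.card A := by exact_mod_cast Fintype.card_pos
  obtain ⟨P, hP, hPp⟩ := exists_measure_singleton (B := A) (p := fun _ => (Fintype.card A : ℝ)⁻¹)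
    (fun _ => by positivity) (by simp)
  set m := Measure.infinitePi fun _ : ℕ => P with hm
  set L := Real.log (Fintype.card A) with hL
  have hpos : m.IsOpenPosMeasure := isOpenPosMeasure_infinitePi A P fun a h => by
    have := hPp a
    rw [measureReal_def, h] at this
    simp only [ENNReal.toReal_zero] at this
    exact (inv_pos.2 hk).ne this
  have hexp : ∫ x, Real.exp (φ x + L) ∂m = 1 := by
    rw [integral_infinitePi_eq_sum_prepend A P (by fun_prop), ← Finset.sum_congr rfl
      fun a _ => integral_const_mul (P.real {a}) _, ← integral_finsetSum]
    · have (x : X A) : ∑ a, P.real {a} * Real.exp (φ (prepend A a x) + L) = 1 := by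
        simp only [hPp, Real.exp_add, hL, Real.exp_log hk]
        rw [← Finset.mul_sum, ← Finset.sum_mul, hnorm x]
        field_simp
      simp [this]
    · intro a _
      have := continuous_prepend A a
      exact integrable_of_continuous A (by fun_prop) _
  have hint : Integrable φ m := integrable_of_continuous A hφc _
  have hint' : Integrable (fun x => Real.exp (φ x + L)) m :=
    integrable_of_continuous A (by fun_prop) _
  obtain ⟨x₀, hx₀⟩ := hne
  have hψ := integral_pos_of_integrable_nonneg_nonzero (μ := m) (x := x₀)
    (f := fun x => Real.exp (φ x + L) - (φ x + L + 1)) (by fun_prop)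
    (hint'.sub ((hint.add (integrable_const _)).add (integrable_const _)))
    (fun x => sub_nonneg.2 (Real.add_one_le_exp _))
    (sub_pos.2 (Real.add_one_lt_exp fun h => hx₀ (by linarith))).ne'
  refine ⟨m, ⟨inferInstance, infinitePi_map_shift P⟩, ?_⟩
  have h2 : Integrable (fun x => φ x + L) m := hint.add (integrable_const _)
  have h3 : Integrable (fun x => φ x + L + 1) m := h2.add (integrable_const _)
  rw [integral_sub hint' h3, hexp, integral_add h2 (integrable_const _),
    integral_add hint (integrable_const _)] at hψ
  simp only [integral_const, probReal_univ, smul_eq_mul, one_mul] at hψ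
  linarith

/-! ### Upper bound for the probability of short return times -/

section Upper

variable {A} {φ : X A → ℝ} {μ : Measure (X A)} {C : ℝ} [IsProbabilityMeasure μ] [Nonempty A]

lemma QuasiGibbs.measureReal_inter_le (hG : QuasiGibbs A φ μ C) {n : ℕ} (w : Fin n → A)
    {B : Set (X A)} (hB : MeasurableSet B) :
    μ.real (cyl A w ∩ (shift A)^[n] ⁻¹' B) ≤
      Real.exp (2 * C) * (μ.real (cyl A w) * μ.real B) := by
  obtain ⟨x, hx⟩ := cyl_nonempty A w
  refine (hG.upper w hx hB).trans ?_
  have h : Real.exp (birkhoffSum (shift A) φ n x + C) ≤ Real.exp (2 * C) * μ.real (cyl A w) := by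
    rw [show birkhoffSum (shift A) φ n x + C = 2 * C + (birkhoffSum (shift A) φ n x - C) by ring,
      Real.exp_add]
    exact mul_le_mul_of_nonneg_left (hG.le_measureReal_cyl hx) (Real.exp_pos _).le
  rw [← mul_assoc]
  exact mul_le_mul_of_nonneg_right h measureReal_nonneg

lemma QuasiGibbs.le_measureReal_inter (hG : QuasiGibbs A φ μ C) {n : ℕ} (w : Fin n → A)
    {B : Set (X A)} (hB : MeasurableSet B) :
    Real.exp (-(2 * C)) * (μ.real (cyl A w) * μ.real B) ≤
      μ.real (cyl A w ∩ (shift A)^[n] ⁻¹' B) := by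
  obtain ⟨x, hx⟩ := cyl_nonempty A w
  refine le_trans ?_ (hG.lower w hx hB)
  have h : Real.exp (-(2 * C)) * μ.real (cyl A w) ≤ Real.exp (birkhoffSum (shift A) φ n x - C) := by
    rw [show birkhoffSum (shift A) φ n x - C = -(2 * C) + (birkhoffSum (shift A) φ n x + C) by ring,
      Real.exp_add]
    exact mul_le_mul_of_nonneg_left (hG.measureReal_cyl_le hx) (Real.exp_pos _).le
  rw [← mul_assoc]
  exact mul_le_mul_of_nonneg_right h measureReal_nonneg

lemma QuasiGibbs.measureReal_inter_le_of_le (hG : QuasiGibbs A φ μ C)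
    (hp : MeasurePreserving (shift A) μ μ) {n j : ℕ} (hj : n ≤ j) (w : Fin n → A)
    {B : Set (X A)} (hB : MeasurableSet B) :
    μ.real (cyl A w ∩ (shift A)^[j] ⁻¹' B) ≤
      Real.exp (2 * C) * (μ.real (cyl A w) * μ.real B) := by
  obtain ⟨i, rfl⟩ := Nat.exists_eq_add_of_le' hj
  rw [Function.iterate_add, Set.preimage_comp,
    ← (hp.iterate i).measureReal_preimage hB.nullMeasurableSet]
  exact hG.measureReal_inter_le w ((hp.iterate i).measurable hB)

/-- The points whose first `n` letters reappear at position `j`. -/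
def returnSet (A : Type*) (n j : ℕ) : Set (X A) := {x | ∀ i < n, x (j + i) = x i}

lemma measure_retTime_eq_zero (hp : MeasurePreserving (shift A) μ μ) (n : ℕ) :
    μ {x | retTime A n x = 0} = 0 := by
  have h1 : ∀ᵐ x ∂μ, ∀ w : Fin n → A, x ∈ cyl A w → ∃ᶠ m in atTop, (shift A)^[m] x ∈ cyl A w :=
    ae_all_iff.2 fun w => hp.conservative.ae_mem_imp_frequently_image_mem
      (measurableSet_cyl A w).nullMeasurableSet
  rw [← compl_mem_ae_iff]
  filter_upwards [h1] with x hx' hx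
  obtain ⟨m, hm, hm'⟩ := frequently_atTop.1 (hx' _ (mem_cyl_word A n x)) 1
  have hmem : m + 1 ∈ {k | 2 ≤ k ∧ ∀ i < n, x (k - 1 + i) = x i} := by
    refine ⟨by omega, fun i hi => ?_⟩
    have := hm' ⟨i, hi⟩
    rw [shift_iterate_apply] at this
    rw [Nat.add_sub_cancel, add_comm]
    exact this
  have h2 : retTime A n x ∈ {k | 2 ≤ k ∧ ∀ i < n, x (k - 1 + i) = x i} := Nat.sInf_mem ⟨_, hmem⟩
  have h3 := h2.1
  rw [show retTime A n x = 0 from hx] at h3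
  omega

lemma retTime_lt_subset {n : ℕ} (hn : 0 < n) (v : ℝ) :
    {x : X A | 1 / (n : ℝ) * Real.log (retTime A n x) < v} ⊆
      {x | retTime A n x = 0} ∪ ((⋃ j ∈ Finset.Ico 1 n, returnSet A n j) ∪
        ⋃ j ∈ Finset.Ico n ⌈Real.exp (n * v)⌉₊, returnSet A n j) := by
  intro x hx
  by_cases h0 : retTime A n x = 0
  · exact Or.inl h0
  have hmem : retTime A n x ∈ {k | 2 ≤ k ∧ ∀ i < n, x (k - 1 + i) = x i} :=
    Nat.sInf_mem (Nat.nonempty_of_pos_sInf (Nat.pos_of_ne_zero h0))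
  have hn' : (0 : ℝ) < n := by exact_mod_cast hn
  have h1 : (retTime A n x : ℝ) < Real.exp (n * v) := by
    rw [← Real.log_lt_iff_lt_exp (by exact_mod_cast Nat.pos_of_ne_zero h0), ← div_lt_iff₀' hn']
    simpa [div_eq_inv_mul] using hx
  have h2 : retTime A n x - 1 < ⌈Real.exp (n * v)⌉₊ :=
    (Nat.sub_le _ _).trans_lt (Nat.lt_ceil.2 h1)
  refine Or.inr ?_
  have h3 := hmem.1
  rcases lt_or_ge (retTime A n x - 1) n with h | h
  · exact Or.inl (Set.mem_biUnion (Finset.mem_coe.2 (Finset.mem_Ico.2 ⟨by omega, h⟩)) hmem.2)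
  · exact Or.inr (Set.mem_biUnion (Finset.mem_coe.2 (Finset.mem_Ico.2 ⟨h, h2⟩)) hmem.2)

lemma cyl_inter_returnSet_subset {n j : ℕ} (hj : 0 < j) (u : Fin j → A) :
    cyl A u ∩ returnSet A n j ⊆ cyl A u ∩ (shift A)^[j] ⁻¹'
      cyl A fun i : Fin n => u ⟨i % j, Nat.mod_lt _ hj⟩ := by
  rintro x ⟨hx, hr⟩
  refine ⟨hx, fun i => ?_⟩
  rw [shift_iterate_apply, add_comm]
  obtain ⟨i, hi⟩ := i
  induction i using Nat.strong_induction_on with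
  | _ i ih =>
    rw [hr i hi]
    rcases lt_or_ge i j with h | h
    · simpa [Nat.mod_eq_of_lt h] using hx ⟨i, h⟩
    · have := ih (i - j) (by omega) (by omega)
      rw [Nat.add_sub_cancel' h] at this
      simpa [Nat.mod_eq_sub_mod h] using this

lemma QuasiGibbs.measureReal_returnSet_le (hG : QuasiGibbs A φ μ C) (hφc : Continuous φ)
    {n j : ℕ} (hn : 0 < n) (hj : 0 < j) :
    μ.real (returnSet A n j) ≤ Real.exp (2 * C) * Real.exp (n * supInt A φ + C) := by
  calc _ ≤ ∑ u : Fin j → A, μ.real (cyl A u ∩ returnSet A n j) := measureReal_le_sum_cyl A μ j _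
    _ ≤ ∑ u : Fin j → A, Real.exp (2 * C) *
        (μ.real (cyl A u) * Real.exp (n * supInt A φ + C)) := by
        refine Finset.sum_le_sum fun u _ => ?_
        refine (measureReal_mono (cyl_inter_returnSet_subset hj u)).trans
          ((hG.measureReal_inter_le u (measurableSet_cyl A _)).trans ?_)
        refine mul_le_mul_of_nonneg_left (mul_le_mul_of_nonneg_left ?_ measureReal_nonneg)
          (Real.exp_pos _).le
        exact (Real.log_le_iff_le_exp (hG.cyl_pos _)).1 (hG.log_measureReal_cyl_le hφc hn _)
    _ = _ := by
        rw [← Finset.mul_sum, ← Finset.sum_mul, sum_measureReal_cyl, one_mul]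

lemma le_exp_mul_of_le_one_of_le_exp {y a t : ℝ} (ht0 : 0 ≤ t) (ht1 : t ≤ 1) (h1 : y ≤ 1)
    (ha : y ≤ Real.exp a) : y ≤ Real.exp (t * a) := by
  rcases le_total 0 a with h | h
  · exact h1.trans (Real.one_le_exp (mul_nonneg ht0 h))
  · exact ha.trans (Real.exp_le_exp.2 (by nlinarith))

lemma QuasiGibbs.measureReal_iUnion_returnSet_le (hG : QuasiGibbs A φ μ C)
    (hp : MeasurePreserving (shift A) μ μ) {n : ℕ} (hn : 0 < n) {v t : ℝ} (ht0 : 0 ≤ t)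
    (ht1 : t ≤ 1) :
    μ.real (⋃ j ∈ Finset.Ico n ⌈Real.exp (n * v)⌉₊, returnSet A n j) ≤
      Real.exp (2 * C) * (Real.exp (t * (n * v)) * partition A μ n (1 + t)) := by
  have hK : 1 ≤ Real.exp (2 * C) := Real.one_le_exp (by linarith [hG.nonneg])
  set J := ⌈Real.exp (n * v)⌉₊ with hJ
  refine (measureReal_le_sum_cyl A μ n _).trans ?_
  rw [partition, Finset.mul_sum, Finset.mul_sum]
  refine Finset.sum_le_sum fun w _ => ?_
  set p := μ.real (cyl A w) with hpdef
  have hp0 : 0 < p := hG.cyl_pos w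
  have h1 : μ.real (cyl A w ∩ ⋃ j ∈ Finset.Ico n J, returnSet A n j) ≤ p :=
    measureReal_mono Set.inter_subset_left
  have h2 : μ.real (cyl A w ∩ ⋃ j ∈ Finset.Ico n J, returnSet A n j) ≤
      Real.exp (2 * C) * p * Real.exp (n * v + Real.log p) := by
    have hsub : (cyl A w ∩ ⋃ j ∈ Finset.Ico n J, returnSet A n j) ⊆
        ⋃ j ∈ Finset.Ico n J, cyl A w ∩ (shift A)^[j] ⁻¹' cyl A w := by
      rintro x ⟨hx, hx'⟩
      obtain ⟨j, hj, hr⟩ := Set.mem_iUnion₂.1 hx'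
      refine Set.mem_iUnion₂.2 ⟨j, hj, hx, fun i => ?_⟩
      rw [shift_iterate_apply, add_comm, hr i i.2, hx i]
    have hJ1 : ((J - n : ℕ) : ℝ) ≤ Real.exp (n * v) := by
      have : J - n < J ∨ J = 0 := by omega
      rcases this with h | h
      · exact (Nat.lt_ceil.1 h).le
      · simp [h, Real.exp_nonneg]
    calc _ ≤ μ.real (⋃ j ∈ Finset.Ico n J, cyl A w ∩ (shift A)^[j] ⁻¹' cyl A w) :=
          measureReal_mono hsub (measure_ne_top _ _)
      _ ≤ ∑ j ∈ Finset.Ico n J, μ.real (cyl A w ∩ (shift A)^[j] ⁻¹' cyl A w) :=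
          measureReal_biUnion_finset_le _ _
      _ ≤ ∑ j ∈ Finset.Ico n J, Real.exp (2 * C) * (p * p) :=
          Finset.sum_le_sum fun j hj => hG.measureReal_inter_le_of_le hp
            (Finset.mem_Ico.1 hj).1 w (measurableSet_cyl A w)
      _ = ((J - n : ℕ) : ℝ) * (Real.exp (2 * C) * (p * p)) := by simp
      _ ≤ Real.exp (n * v) * (Real.exp (2 * C) * (p * p)) :=
          mul_le_mul_of_nonneg_right hJ1 (by positivity)
      _ = _ := by rw [Real.exp_add, Real.exp_log hp0]; ring
  have hKp : 0 < Real.exp (2 * C) * p := by positivity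
  have h3 := le_exp_mul_of_le_one_of_le_exp ht0 ht1
    (y := μ.real (cyl A w ∩ ⋃ j ∈ Finset.Ico n J, returnSet A n j) / (Real.exp (2 * C) * p))
    ((div_le_one hKp).2 (h1.trans (le_mul_of_one_le_left hp0.le hK)))
    ((div_le_iff₀' hKp).2 h2)
  rw [div_le_iff₀' hKp] at h3
  refine h3.trans_eq ?_
  rw [add_mul, one_mul, mul_add, Real.exp_add, Real.exp_add, Real.exp_log hp0]
  ring

lemma QuasiGibbs.measureReal_retTime_lt_le (hG : QuasiGibbs A φ μ C) (hφc : Continuous φ)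
    (hp : MeasurePreserving (shift A) μ μ) {n : ℕ} (hn : 0 < n) {v q : ℝ} (hq0 : q ≤ 0)
    (hq1 : -1 ≤ q) (hsup : supInt A φ ≤ pressure A (fun x => (1 - q) * φ x) - q * v) :
    μ.real {x | 1 / (n : ℝ) * Real.log (retTime A n x) < v} ≤
      (n + 1) * Real.exp (4 * C + n * (pressure A (fun x => (1 - q) * φ x) - q * v)) := by
  set T := pressure A (fun x => (1 - q) * φ x) - q * v with hT
  have hC := hG.nonneg
  have hzero : μ.real {x | retTime A n x = 0} = 0 := by
    rw [measureReal_def, measure_retTime_eq_zero hp, ENNReal.toReal_zero]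
  have hshort : μ.real (⋃ j ∈ Finset.Ico 1 n, returnSet A n j) ≤
      n * Real.exp (4 * C + n * T) := by
    calc _ ≤ ∑ j ∈ Finset.Ico 1 n, μ.real (returnSet A n j) := measureReal_biUnion_finset_le _ _
      _ ≤ ∑ j ∈ Finset.Ico 1 n, Real.exp (4 * C + n * T) := by
          refine Finset.sum_le_sum fun j hj => (hG.measureReal_returnSet_le hφc hn
            (Finset.mem_Ico.1 hj).1).trans ?_
          rw [← Real.exp_add, Real.exp_le_exp]
          have := mul_le_mul_of_nonneg_left hsup (Nat.cast_nonneg (α := ℝ) n)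
          linarith
      _ = ((n - 1 : ℕ) : ℝ) * Real.exp (4 * C + n * T) := by simp
      _ ≤ _ := by
          refine mul_le_mul_of_nonneg_right ?_ (Real.exp_pos _).le
          exact_mod_cast Nat.sub_le n 1
  have hlong : μ.real (⋃ j ∈ Finset.Ico n ⌈Real.exp (n * v)⌉₊, returnSet A n j) ≤
      Real.exp (4 * C + n * T) := by
    refine (hG.measureReal_iUnion_returnSet_le hp hn (t := -q) (by linarith)
      (by linarith)).trans ?_
    have h1 := hG.log_partition_le hφc hn (1 - q)
    rw [Real.log_le_iff_le_exp (partition_pos A μ n _), abs_of_nonneg (by linarith)] at h1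
    rw [← sub_eq_add_neg]
    refine (mul_le_mul_of_nonneg_left (mul_le_mul_of_nonneg_left h1 (Real.exp_pos _).le)
      (Real.exp_pos _).le).trans ?_
    rw [← Real.exp_add, ← Real.exp_add, Real.exp_le_exp, hT]
    nlinarith
  calc _ ≤ _ := measureReal_mono (retTime_lt_subset hn v)
    _ ≤ _ := measureReal_union_le _ _
    _ ≤ 0 + (n * Real.exp (4 * C + n * T) + Real.exp (4 * C + n * T)) :=
        add_le_add hzero.le ((measureReal_union_le _ _).trans (add_le_add hshort hlong))
    _ = _ := by ring

end Upper

/-! ### From large cylinders to short return times -/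

section Return

variable {A} {φ : X A → ℝ} {μ : Measure (X A)} {C : ℝ} [IsProbabilityMeasure μ] [Nonempty A]

/-- The points which do not visit `[w]` at the times `0, n, …, (L - 1) n`. -/
def avoidSet {A : Type*} {n : ℕ} (w : Fin n → A) (L : ℕ) : Set (X A) :=
  {x | ∀ l < L, (shift A)^[l * n] x ∉ cyl A w}

lemma avoidSet_succ {n : ℕ} (w : Fin n → A) (L : ℕ) :
    avoidSet w (L + 1) = (shift A)^[n] ⁻¹' avoidSet w L \ cyl A w := by
  ext x
  simp only [avoidSet, Set.mem_ofPred_eq, Set.mem_sdiff, Set.mem_preimage,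
    ← Function.iterate_add_apply]
  refine ⟨fun H => ⟨fun l hl => ?_, by simpa using H 0 L.succ_pos⟩, fun H l hl => ?_⟩
  · rw [show l * n + n = (l + 1) * n by ring]
    exact H _ (by omega)
  · cases l with
    | zero => simpa using H.2
    | succ l =>
      rw [show (l + 1) * n = l * n + n by ring]
      exact H.1 l (by omega)

lemma measurableSet_avoidSet {n : ℕ} (w : Fin n → A) (L : ℕ) :
    MeasurableSet (avoidSet w L) := by
  induction L with
  | zero => simp [avoidSet]
  | succ L ih =>
    rw [avoidSet_succ]
    exact (((continuous_shift A).iterate n).measurable ih).diff (measurableSet_cyl A w)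

lemma QuasiGibbs.measureReal_avoidSet_le (hG : QuasiGibbs A φ μ C)
    (hp : MeasurePreserving (shift A) μ μ) {n : ℕ} (w : Fin n → A) (L : ℕ) :
    μ.real (avoidSet w L) ≤ (1 - Real.exp (-(2 * C)) * μ.real (cyl A w)) ^ L := by
  have hle : Real.exp (-(2 * C)) * μ.real (cyl A w) ≤ 1 :=
    mul_le_one₀ (Real.exp_le_one_iff.2 (by linarith [hG.nonneg])) measureReal_nonneg
      measureReal_le_one
  induction L with
  | zero => simp
  | succ L ih =>
    have hm := measurableSet_avoidSet w L
    have h1 := measureReal_inter_add_sdiff (μ := μ) (s := (shift A)^[n] ⁻¹' avoidSet w L)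
      (measurableSet_cyl A w)
    rw [(hp.iterate n).measureReal_preimage hm.nullMeasurableSet, Set.inter_comm] at h1
    have h2 := hG.le_measureReal_inter w hm
    rw [avoidSet_succ, pow_succ']
    calc _ ≤ (1 - Real.exp (-(2 * C)) * μ.real (cyl A w)) * μ.real (avoidSet w L) := by linarith
      _ ≤ _ := mul_le_mul_of_nonneg_left ih (by linarith)

lemma QuasiGibbs.le_measureReal_inter_avoidSet_compl (hG : QuasiGibbs A φ μ C)
    (hp : MeasurePreserving (shift A) μ μ) {n : ℕ} (w : Fin n → A) {L : ℕ}
    (hL : 1 ≤ Real.exp (-(2 * C)) * μ.real (cyl A w) * L) :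
    Real.exp (-(2 * C)) / 2 * μ.real (cyl A w) ≤
      μ.real (cyl A w ∩ (shift A)^[n] ⁻¹' (avoidSet w L)ᶜ) := by
  have hm := measurableSet_avoidSet w L
  refine le_trans ?_ (hG.le_measureReal_inter w hm.compl)
  have h1 : μ.real (avoidSet w L) ≤ 1 / 2 := by
    refine (hG.measureReal_avoidSet_le hp w L).trans ?_
    set y := Real.exp (-(2 * C)) * μ.real (cyl A w)
    have hy : y ≤ 1 := mul_le_one₀ (Real.exp_le_one_iff.2 (by linarith [hG.nonneg]))
      measureReal_nonneg measureReal_le_one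
    calc (1 - y) ^ L ≤ Real.exp (-y) ^ L :=
          pow_le_pow_left₀ (by linarith) (by linarith [Real.add_one_le_exp (-y)]) L
      _ = Real.exp (-(y * L)) := by rw [← Real.exp_nat_mul]; ring_nf
      _ ≤ Real.exp (-1) := Real.exp_le_exp.2 (by linarith)
      _ ≤ 1 / 2 := by
          rw [Real.exp_neg, one_div]
          exact inv_anti₀ two_pos (by linarith [Real.add_one_le_exp (1 : ℝ)])
  rw [probReal_compl_eq_one_sub hm, div_mul_eq_mul_div, mul_div_assoc]
  refine mul_le_mul_of_nonneg_left ?_ (Real.exp_pos _).le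
  nlinarith [measureReal_nonneg (μ := μ) (s := cyl A w)]

lemma cyl_inter_avoidSet_compl_subset {n L : ℕ} (hn : 0 < n) {v : ℝ}
    (hL : (L * n + 1 : ℝ) < Real.exp (n * v)) (w : Fin n → A) :
    cyl A w ∩ (shift A)^[n] ⁻¹' (avoidSet w L)ᶜ ⊆
      {x | 1 / (n : ℝ) * Real.log (retTime A n x) < v} := by
  rintro x ⟨hx, hx'⟩
  simp only [avoidSet, Set.mem_preimage, Set.mem_compl_iff, Set.mem_ofPred_eq, not_forall,
    not_not, ← Function.iterate_add_apply] at hx'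
  obtain ⟨l, hl, hmem⟩ := hx'
  have hn' : (0 : ℝ) < n := by exact_mod_cast hn
  have hret : l * n + n + 1 ∈ {k | 2 ≤ k ∧ ∀ i < n, x (k - 1 + i) = x i} := by
    refine ⟨by omega, fun i hi => ?_⟩
    have := hmem ⟨i, hi⟩
    rw [shift_iterate_apply] at this
    rw [Nat.add_sub_cancel, add_comm]
    exact this.trans (hx ⟨i, hi⟩).symm
  have h1 : retTime A n x ≤ l * n + n + 1 := Nat.sInf_le hret
  have h2 : 2 ≤ retTime A n x := (Nat.sInf_mem (s := {k | 2 ≤ k ∧ _}) ⟨_, hret⟩).1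
  have h3 : l * n + n + 1 ≤ L * n + 1 := by
    have := Nat.mul_le_mul_right n (Nat.succ_le_of_lt hl)
    rw [Nat.succ_mul] at this
    omega
  have h4 : (retTime A n x : ℝ) < Real.exp (n * v) :=
    lt_of_le_of_lt (by exact_mod_cast h1.trans h3) hL
  rw [Set.mem_ofPred_eq, one_div, inv_mul_lt_iff₀ hn',
    Real.log_lt_iff_lt_exp (by exact_mod_cast (by omega : 0 < retTime A n x))]
  exact h4

lemma QuasiGibbs.le_measureReal_retTime_lt (hG : QuasiGibbs A φ μ C)
    (hp : MeasurePreserving (shift A) μ μ) {n L : ℕ} (hn : 0 < n) {v v' : ℝ}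
    (hL : (L * n + 1 : ℝ) < Real.exp (n * v)) (hL' : Real.exp (n * v' + 3 * C) ≤ L) :
    Real.exp (-(2 * C)) / 2 * μ.real {x | -(n * v') ≤ birkhoffSum (shift A) φ n x} ≤
      μ.real {x | 1 / (n : ℝ) * Real.log (retTime A n x) < v} := by
  classical
  set S := {x | -(n * v') ≤ birkhoffSum (shift A) φ n x} with hS
  set W : Finset (Fin n → A) := Finset.univ.filter fun w => (cyl A w ∩ S).Nonempty with hW
  have hbig (w : Fin n → A) (hw : w ∈ W) :
      1 ≤ Real.exp (-(2 * C)) * μ.real (cyl A w) * L := by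
    obtain ⟨x, hx, hxS⟩ := (Finset.mem_filter.1 hw).2
    have hxS : -(n * v') ≤ birkhoffSum (shift A) φ n x := hxS
    have h1 : Real.exp (-(n * v') - C) ≤ μ.real (cyl A w) :=
      (Real.exp_le_exp.2 (by linarith)).trans (hG.le_measureReal_cyl hx)
    calc (1 : ℝ) = Real.exp (-(2 * C)) * Real.exp (-(n * v') - C) *
          Real.exp (n * v' + 3 * C) := by
          rw [← Real.exp_add, ← Real.exp_add]
          ring_nf
          exact Real.exp_zero.symm
      _ ≤ _ := by gcongr
  have hdisj : (W : Set (Fin n → A)).PairwiseDisjoint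
      fun w => cyl A w ∩ (shift A)^[n] ⁻¹' (avoidSet w L)ᶜ := fun w _ w' _ h =>
    (pairwise_disjoint_cyl A n h).mono Set.inter_subset_left Set.inter_subset_left
  have hmeas (w : Fin n → A) :
      MeasurableSet (cyl A w ∩ (shift A)^[n] ⁻¹' (avoidSet w L)ᶜ) :=
    (measurableSet_cyl A w).inter ((hp.iterate n).measurable (measurableSet_avoidSet w L).compl)
  calc _ ≤ Real.exp (-(2 * C)) / 2 * ∑ w ∈ W, μ.real (cyl A w) := by
        refine mul_le_mul_of_nonneg_left ?_ (by positivity)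
        refine (measureReal_mono (fun x hx => ?_) (measure_ne_top _ _)).trans
          (measureReal_biUnion_finset_le W fun w => cyl A w)
        refine Set.mem_iUnion₂.2 ⟨word A n x, ?_, mem_cyl_word A n x⟩
        exact Finset.mem_filter.2 ⟨Finset.mem_univ _, x, mem_cyl_word A n x, hx⟩
    _ ≤ ∑ w ∈ W, μ.real (cyl A w ∩ (shift A)^[n] ⁻¹' (avoidSet w L)ᶜ) := by
        rw [Finset.mul_sum]
        exact Finset.sum_le_sum fun w hw =>
          hG.le_measureReal_inter_avoidSet_compl hp w (hbig w hw)
    _ = μ.real (⋃ w ∈ W, cyl A w ∩ (shift A)^[n] ⁻¹' (avoidSet w L)ᶜ) :=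
        (measureReal_biUnion_finset hdisj fun w _ => hmeas w).symm
    _ ≤ _ := measureReal_mono
        (Set.iUnion₂_subset fun w _ => cyl_inter_avoidSet_compl_subset hn hL w)
        (measure_ne_top _ _)

lemma QuasiGibbs.eventually_le_measureReal_retTime_lt (hG : QuasiGibbs A φ μ C)
    (hp : MeasurePreserving (shift A) μ μ) {v v' : ℝ} (hv' : 0 ≤ v') (hvv : v' < v) :
    ∀ᶠ n : ℕ in atTop, Real.exp (-(2 * C)) / 2 *
        μ.real {x | -(n * v') ≤ birkhoffSum (shift A) φ n x} ≤
      μ.real {x | 1 / (n : ℝ) * Real.log (retTime A n x) < v} := by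
  have hd : 0 < v - v' := sub_pos.2 hvv
  have h1 : Tendsto (fun n : ℕ => Real.exp ((v - v') * n) / (n : ℝ)) atTop atTop := by
    simpa [Function.comp_def] using (tendsto_exp_mul_div_rpow_atTop 1 (v - v') hd).comp tendsto_natCast_atTop_atTop
  filter_upwards [h1.eventually_ge_atTop (3 + Real.exp (3 * C)), eventually_gt_atTop 0]
    with n hn hn0
  have hn' : (0 : ℝ) < n := by exact_mod_cast hn0
  have hn1 : (1 : ℝ) ≤ n := by exact_mod_cast hn0
  rw [le_div_iff₀ hn'] at hn
  have hv1 : 1 ≤ Real.exp (n * v') := Real.one_le_exp (by positivity)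
  have h2 : (3 + Real.exp (3 * C)) * n * Real.exp (n * v') ≤ Real.exp (n * v) := by
    rw [show (n : ℝ) * v = (v - v') * n + n * v' by ring, Real.exp_add]
    exact mul_le_mul_of_nonneg_right hn (Real.exp_pos _).le
  have h3 : (3 : ℝ) * n ≤ 3 * n * Real.exp (n * v') := le_mul_of_one_le_right (by positivity) hv1
  have h4 : 0 ≤ (Real.exp (n * v) - 2) / n := by
    refine div_nonneg ?_ hn'.le
    nlinarith [mul_pos (mul_pos (Real.exp_pos (3 * C)) hn') (Real.exp_pos (n * v'))]
  refine hG.le_measureReal_retTime_lt hp (L := ⌊(Real.exp (n * v) - 2) / n⌋₊) hn0 ?_ ?_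
  · have := Nat.floor_le h4
    rw [le_div_iff₀ hn'] at this
    linarith
  · refine le_trans ?_ (Nat.sub_one_lt_floor _).le
    rw [le_sub_iff_add_le, le_div_iff₀ hn', Real.exp_add]
    nlinarith

end Return

/-! ### Cramér's lower bound for finite families -/

section Cramer

variable {ι : Type*} [Fintype ι] [Nonempty ι] {p Y : ι → ℝ}

lemma exists_isMinOn_hasDerivAt_zero {G G' : ℝ → ℝ} (hG : ∀ q, HasDerivAt G (G' q) q)
    {a a' b b' : ℝ} (haa : a < a') (hab : a' ≤ b) (hba : a ≤ b') (hbb : b' < b)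
    (ha : G a' < G a) (hb : G b' < G b) : ∃ q ∈ Set.Icc a b, HasDerivAt G 0 q := by
  have hc : Continuous G := continuous_iff_continuousAt.2 fun q => (hG q).continuousAt
  obtain ⟨q, hq, hmin⟩ := isCompact_Icc.exists_isMinOn
    (Set.nonempty_Icc.2 (haa.le.trans hab)) hc.continuousOn
  have h1 : q ≠ a := fun h => ha.not_ge (h ▸ hmin ⟨haa.le, hab⟩)
  have h2 : q ≠ b := fun h => hb.not_ge (h ▸ hmin ⟨hba, hbb.le⟩)
  have h3 : IsLocalMin G q :=
    hmin.isLocalMin (Icc_mem_nhds (lt_of_le_of_ne hq.1 h1.symm) (lt_of_le_of_ne hq.2 h2))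
  exact ⟨q, hq, h3.hasDerivAt_eq_zero (hG q) ▸ hG q⟩

lemma exists_mul_exp_neg_lt {G : ℝ → ℝ} {q : ℝ} (hG : HasDerivAt G 0 q) (hpos : 0 < G q) :
    ∃ ε, 0 < ε ∧ G (q + ε) * Real.exp (-ε) < G q ∧ G (q - ε) * Real.exp (-ε) < G q := by
  have h1 := (hasDerivAt_iff_isLittleO_nhds_zero.1 hG).def (half_pos hpos)
  obtain ⟨ε, hε, h2⟩ := Metric.eventually_nhds_iff.1 h1
  have h3 (h : ℝ) (hh : |h| = ε / 2) : G (q + h) * Real.exp (-(ε / 2)) < G q := by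
    have h4 := h2 (y := h) (by rw [Real.dist_eq, sub_zero, hh]; linarith)
    simp only [smul_zero, sub_zero, Real.norm_eq_abs, hh] at h4
    rw [Real.exp_neg, ← div_eq_mul_inv, div_lt_iff₀ (Real.exp_pos _)]
    have h5 := (abs_le.1 h4).2
    have h6 := mul_lt_mul_of_pos_left (Real.add_one_lt_exp (half_pos hε).ne') hpos
    nlinarith
  refine ⟨ε / 2, half_pos hε, h3 _ (abs_of_pos (half_pos hε)), ?_⟩
  rw [sub_eq_add_neg]
  exact h3 _ (by rw [abs_neg, abs_of_pos (half_pos hε)])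

lemma sum_prod_mul_exp (p Y : ι → ℝ) (q : ℝ) (k : ℕ) :
    ∑ b : Fin k → ι, (∏ i, p (b i)) * Real.exp (q * ∑ i, Y (b i)) =
      (∑ w, p w * Real.exp (q * Y w)) ^ k := by
  rw [Fintype.sum_pow]
  refine Finset.sum_congr rfl fun b _ => ?_
  rw [Finset.prod_mul_distrib, Finset.mul_sum, Real.exp_sum]

lemma exists_eventually_le_sum_prod (hp : ∀ w, 0 < p w) {a a' b b' : ℝ} (haa : a < a')
    (hab : a' ≤ b) (hba : a ≤ b') (hbb : b' < b)
    (ha : ∑ w, p w * Real.exp (a' * Y w) < ∑ w, p w * Real.exp (a * Y w))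
    (hb : ∑ w, p w * Real.exp (b' * Y w) < ∑ w, p w * Real.exp (b * Y w)) :
    ∃ q ∈ Set.Icc a b, ∀ᶠ k : ℕ in atTop,
      Real.exp (k * (Real.log (∑ w, p w * Real.exp (q * Y w)) - |q|)) / 2 ≤
        ∑ c : Fin k → ι with |∑ i, Y (c i)| ≤ k, ∏ i, p (c i) := by
  set G : ℝ → ℝ := fun q => ∑ w, p w * Real.exp (q * Y w) with hGdef
  have hder (q : ℝ) : HasDerivAt G (∑ w, p w * (Real.exp (q * Y w) * Y w)) q :=
    HasDerivAt.fun_sum fun w _ => by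
      have := ((hasDerivAt_id q).mul_const (Y w)).exp.const_mul (p w)
      simpa using this
  have hGpos (q : ℝ) : 0 < G q :=
    Finset.sum_pos (fun w _ => mul_pos (hp w) (Real.exp_pos _)) Finset.univ_nonempty
  obtain ⟨q, hq, hq'⟩ := exists_isMinOn_hasDerivAt_zero hder haa hab hba hbb ha hb
  obtain ⟨ε, hε, h1, h2⟩ := exists_mul_exp_neg_lt hq' (hGpos q)
  refine ⟨q, hq, ?_⟩
  have hZ := hGpos q
  have hlim (r : ℝ) (hr : r * Real.exp (-ε) < G q) (hr0 : 0 < r) :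
      ∀ᶠ k : ℕ in atTop, (r * Real.exp (-ε)) ^ k ≤ G q ^ k / 4 := by
    have h3 := tendsto_pow_atTop_nhds_zero_of_lt_one (r := r * Real.exp (-ε) / G q)
      (by positivity) ((div_lt_one hZ).2 hr)
    filter_upwards [h3.eventually_le_const (show (0 : ℝ) < 1 / 4 by norm_num)] with k hk
    rw [div_pow, div_le_iff₀ (pow_pos hZ k)] at hk
    linarith
  filter_upwards [hlim _ h1 (hGpos _), hlim _ h2 (hGpos _)] with k hk1 hk2
  have hprod (c : Fin k → ι) : 0 < ∏ i, p (c i) := Finset.prod_pos fun i _ => hp _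
  have hterm (c : Fin k → ι) : (∏ i, p (c i)) * Real.exp (q * ∑ i, Y (c i)) ≤
      (if |∑ i, Y (c i)| ≤ k then (∏ i, p (c i)) * Real.exp (k * |q|) else 0) +
      ((∏ i, p (c i)) * Real.exp ((q + ε) * ∑ i, Y (c i)) * Real.exp (-ε) ^ k +
      (∏ i, p (c i)) * Real.exp ((q - ε) * ∑ i, Y (c i)) * Real.exp (-ε) ^ k) := by
    have h0 := (hprod c).le
    set s := ∑ i, Y (c i)
    have hA : 0 ≤ (∏ i, p (c i)) * Real.exp ((q + ε) * s) * Real.exp (-ε) ^ k := by positivity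
    have hB : 0 ≤ (∏ i, p (c i)) * Real.exp ((q - ε) * s) * Real.exp (-ε) ^ k := by positivity
    split_ifs with hs
    · have h4 : (∏ i, p (c i)) * Real.exp (q * s) ≤ (∏ i, p (c i)) * Real.exp (k * |q|) := by
        refine mul_le_mul_of_nonneg_left (Real.exp_le_exp.2 ?_) h0
        calc q * s ≤ |q * s| := le_abs_self _
          _ = |s| * |q| := by rw [abs_mul, mul_comm]
          _ ≤ k * |q| := mul_le_mul_of_nonneg_right hs (abs_nonneg q)
      linarith
    · have h4 (σ : ℝ) (hσ : k ≤ σ * s) : (∏ i, p (c i)) * Real.exp (q * s) ≤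
          (∏ i, p (c i)) * Real.exp ((q + σ * ε) * s) * Real.exp (-ε) ^ k := by
        rw [mul_assoc, ← Real.exp_nat_mul, ← Real.exp_add]
        exact mul_le_mul_of_nonneg_left (Real.exp_le_exp.2 (by nlinarith)) h0
      rcases lt_abs.1 (not_le.1 hs) with h | h
      · have := h4 1 (by linarith)
        rw [one_mul] at this
        linarith
      · have := h4 (-1) (by linarith)
        rw [neg_one_mul, ← sub_eq_add_neg] at this
        linarith
  have hsum := Finset.sum_le_sum fun c (_ : c ∈ (Finset.univ : Finset (Fin k → ι))) => hterm c
  rw [sum_prod_mul_exp, Finset.sum_add_distrib, Finset.sum_add_distrib, ← Finset.sum_mul,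
    ← Finset.sum_mul, sum_prod_mul_exp, sum_prod_mul_exp, ← mul_pow, ← mul_pow,
    ← Finset.sum_filter, ← Finset.sum_mul] at hsum
  have h5 : G q ^ k / 2 ≤
      (∑ c : Fin k → ι with |∑ i, Y (c i)| ≤ k, ∏ i, p (c i)) * Real.exp (k * |q|) := by
    linarith
  rw [mul_sub, Real.exp_sub, Real.exp_nat_mul, Real.exp_log hZ, div_right_comm,
    div_le_iff₀ (Real.exp_pos _)]
  exact h5

end Cramer

/-! ### Lower bound for the measure of large cylinders -/

section Lower

variable {A} {φ : X A → ℝ} {μ : Measure (X A)} {C : ℝ} [IsProbabilityMeasure μ] [Nonempty A]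

/-- The points whose first `k` blocks of length `N` are `c 0, …, c (k - 1)`. -/
def blockCyl {A : Type*} {k N : ℕ} (c : Fin k → Fin N → A) : Set (X A) :=
  {x | ∀ i : Fin k, (shift A)^[i.val * N] x ∈ cyl A (c i)}

lemma measurableSet_blockCyl {k N : ℕ} (c : Fin k → Fin N → A) :
    MeasurableSet (blockCyl c) := by
  rw [blockCyl, Set.ofPred_forall]
  exact MeasurableSet.iInter fun i =>
    ((continuous_shift A).iterate _).measurable (measurableSet_cyl A _)

lemma disjoint_blockCyl {k N : ℕ} {c c' : Fin k → Fin N → A} (h : c ≠ c') :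
    Disjoint (blockCyl c) (blockCyl c') := by
  refine Set.disjoint_left.2 fun x hx hx' => h ?_
  ext i l
  rw [← hx i l, hx' i l]

lemma blockCyl_succ {k N : ℕ} (c : Fin (k + 1) → Fin N → A) :
    blockCyl c = cyl A (c 0) ∩ (shift A)^[N] ⁻¹' blockCyl (Fin.tail c) := by
  ext x
  simp only [blockCyl, Set.mem_ofPred_eq, Fin.forall_fin_succ, Set.mem_inter_iff,
    Set.mem_preimage, ← Function.iterate_add_apply, Fin.tail]
  simp [Nat.succ_mul]

lemma QuasiGibbs.le_measureReal_blockCyl (hG : QuasiGibbs A φ μ C) {k N : ℕ}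
    (c : Fin k → Fin N → A) :
    Real.exp (-(2 * C)) ^ k * ∏ i, μ.real (cyl A (c i)) ≤ μ.real (blockCyl c) := by
  induction k with
  | zero => simp [blockCyl]
  | succ k ih =>
    rw [blockCyl_succ, Fin.prod_univ_succ, pow_succ']
    refine le_trans ?_ (hG.le_measureReal_inter (c 0) (measurableSet_blockCyl _))
    have h := mul_le_mul_of_nonneg_left (ih (Fin.tail c))
      (show 0 ≤ Real.exp (-(2 * C)) * μ.real (cyl A (c 0)) by positivity)
    refine le_trans (le_of_eq ?_) (h.trans_eq ?_)
    · simp only [Fin.tail]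
      ring
    · ring

lemma QuasiGibbs.le_birkhoffSum_of_mem_blockCyl (hG : QuasiGibbs A φ μ C) {k N : ℕ}
    {c : Fin k → Fin N → A} {x : X A} (hx : x ∈ blockCyl c) :
    ∑ i, Real.log (μ.real (cyl A (c i))) - k * C ≤ birkhoffSum (shift A) φ (k * N) x := by
  induction k generalizing x with
  | zero => simp
  | succ k ih =>
    rw [blockCyl_succ] at hx
    have h1 := ih hx.2
    have h2 := (abs_le.1 (hG.abs_sub_log_le hx.1)).1
    rw [Fin.sum_univ_succ, Nat.succ_mul, add_comm (k * N), birkhoffSum_add]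
    simp only [Fin.tail] at h1
    push_cast
    linarith

lemma le_birkhoffSum {M : ℝ} (hM : ∀ x, |φ x| ≤ M) (n : ℕ) (x : X A) :
    -(n * M) ≤ birkhoffSum (shift A) φ n x := by
  rw [birkhoffSum, ← mul_neg, ← nsmul_eq_mul, ← Finset.card_range n, ← Finset.sum_const,
    Finset.card_range]
  exact Finset.sum_le_sum fun j _ => (abs_le.1 (hM _)).1

end Lower

section LowerAsymptotics

variable {A} {φ : X A → ℝ} {μ : Measure (X A)} {C : ℝ} [IsProbabilityMeasure μ] [Nonempty A]

lemma QuasiGibbs.sum_prod_le_measureReal_birkhoffSum (hG : QuasiGibbs A φ μ C)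
    {M : ℝ} (hM : ∀ x, |φ x| ≤ M) {k N r : ℕ} (hr : r ≤ N) {v v' : ℝ}
    (h : k * (1 + C + N * v) + N * M ≤ (k * N + r : ℕ) * v') :
    Real.exp (-(2 * C)) ^ k * ∑ c : Fin k → Fin N → A with
        |∑ i, (-Real.log (μ.real (cyl A (c i))) - N * v)| ≤ k, ∏ i, μ.real (cyl A (c i)) ≤
      μ.real {x | -((k * N + r : ℕ) * v') ≤ birkhoffSum (shift A) φ (k * N + r) x} := by
  set W := Finset.univ.filter fun c : Fin k → Fin N → A =>
    |∑ i, (-Real.log (μ.real (cyl A (c i))) - N * v)| ≤ k with hW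
  have hM0 : 0 ≤ M := (abs_nonneg _).trans (hM (Classical.arbitrary _))
  calc _ ≤ ∑ c ∈ W, μ.real (blockCyl c) := by
        rw [Finset.mul_sum]
        exact Finset.sum_le_sum fun c _ => hG.le_measureReal_blockCyl c
    _ = μ.real (⋃ c ∈ W, blockCyl c) :=
        (measureReal_biUnion_finset (fun c _ c' _ hc => disjoint_blockCyl hc)
          fun c _ => measurableSet_blockCyl c).symm
    _ ≤ _ := measureReal_mono (Set.iUnion₂_subset fun c hc x hx => ?_) (measure_ne_top _ _)
  have h1 := (abs_le.1 (Finset.mem_filter.1 hc).2).2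
  have h2 := hG.le_birkhoffSum_of_mem_blockCyl hx
  have h3 := le_birkhoffSum hM r ((shift A)^[k * N] x)
  have h4 : (r : ℝ) * M ≤ N * M := mul_le_mul_of_nonneg_right (by exact_mod_cast hr) hM0
  rw [Finset.sum_sub_distrib, Finset.sum_neg_distrib, Finset.sum_const, Finset.card_univ,
    Fintype.card_fin, nsmul_eq_mul] at h1
  rw [Set.mem_ofPred_eq, birkhoffSum_add]
  linarith

lemma QuasiGibbs.exists_eventually_le_sum_prod (hG : QuasiGibbs A φ μ C) (hφc : Continuous φ)
    {N : ℕ} (hN : 0 < N) {qs v I : ℝ} (hqs : qs ∈ Set.Ioo (-1 : ℝ) 0)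
    (hlog : v < Real.log (Fintype.card A))
    {ν : Measure (X A)} (hν : InvProb A ν)
    (hνeq : entropy A ν + (1 - qs) * ∫ x, φ x ∂ν = pressure A fun x => (1 - qs) * φ x)
    (hNC : 5 * C < N * (v + ∫ x, φ x ∂ν))
    (hI : ∀ q ∈ Set.Icc (-2 : ℝ) 1, q * v - pressure A (fun x => (1 - q) * φ x) ≤ I) :
    ∀ᶠ k : ℕ in atTop, Real.exp (-(k * (N * I + 3 * C + 2))) / 2 ≤
      ∑ c : Fin k → Fin N → A with
        |∑ i, (-Real.log (μ.real (cyl A (c i))) - N * v)| ≤ k, ∏ i, μ.real (cyl A (c i)) := by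
  have hN' : (0 : ℝ) < N := by exact_mod_cast hN
  have hC := hG.nonneg
  have hterm (q : ℝ) : ∑ w : Fin N → A, μ.real (cyl A w) *
      Real.exp (q * (-Real.log (μ.real (cyl A w)) - N * v)) =
        Real.exp (-(q * (N * v))) * partition A μ N (1 - q) := by
    rw [partition, Finset.mul_sum]
    refine Finset.sum_congr rfl fun w _ => ?_
    nth_rewrite 1 [← Real.exp_log (hG.cyl_pos w)]
    rw [← Real.exp_add, ← Real.exp_add]
    ring_nf
  have hpart (q : ℝ) : partition A μ N q = Real.exp (Real.log (partition A μ N q)) :=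
    (Real.exp_log (partition_pos A μ N q)).symm
  obtain ⟨q, hq, hev⟩ := RTSpec.exists_eventually_le_sum_prod
    (p := fun w : Fin N → A => μ.real (cyl A w))
    (Y := fun w : Fin N → A => -Real.log (μ.real (cyl A w)) - N * v)
    (fun w => hG.cyl_pos w) (a := qs - 1) (a' := qs) (b' := 0) (b := 1)
    (by linarith) (by linarith [hqs.2]) (by linarith [hqs.2]) one_pos
    (by
      rw [hterm, hterm, hpart, hpart (1 - (qs - 1)), ← Real.exp_add, ← Real.exp_add,
        Real.exp_lt_exp]
      have h1 := hG.log_partition_le hφc hN (1 - qs)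
      have h2 := hG.mul_pressure_le hφc hN (1 - (qs - 1))
      have h3 := mul_le_mul_of_nonneg_left (hG.le_pressure hφc (1 - (qs - 1)) hν) hN'.le
      rw [abs_of_pos (by linarith [hqs.2]), ← hνeq] at h1
      rw [abs_of_pos (by linarith [hqs.2])] at h2
      have h4 : (1 - qs + (1 - (qs - 1))) * C ≤ 5 * C :=
        mul_le_mul_of_nonneg_right (by linarith [hqs.1]) hC
      nlinarith)
    (by
      rw [hterm, hterm, sub_zero, hG.partition_one, sub_self]
      have : partition A μ N 0 = Real.exp (N * Real.log (Fintype.card A)) := by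
        rw [Real.exp_nat_mul, Real.exp_log (by exact_mod_cast Fintype.card_pos)]
        simp [partition]
      rw [this, ← Real.exp_add, zero_mul, neg_zero, Real.exp_zero, one_mul, Real.one_lt_exp_iff]
      nlinarith)
  have hq2 : q ∈ Set.Icc (-2 : ℝ) 1 := ⟨by linarith [hqs.1, hq.1], hq.2⟩
  filter_upwards [hev] with k hk
  refine le_trans ?_ hk
  rw [hterm, Real.log_mul (Real.exp_pos _).ne' (partition_pos A μ N _).ne', Real.log_exp]
  refine div_le_div_of_nonneg_right (Real.exp_le_exp.2 ?_) two_pos.le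
  rw [← mul_neg]
  refine mul_le_mul_of_nonneg_left ?_ (Nat.cast_nonneg k)
  have h1 := hG.mul_pressure_le hφc hN (1 - q)
  have h2 := mul_le_mul_of_nonneg_left (hI q hq2) hN'.le
  have h3 : |1 - q| * C ≤ 3 * C :=
    mul_le_mul_of_nonneg_right (abs_le.2 ⟨by linarith [hq2.2], by linarith [hq2.1]⟩) hC
  have h4 : |q| ≤ 2 := abs_le.2 ⟨hq2.1, by linarith [hq2.2]⟩
  linarith

lemma QuasiGibbs.eventually_le_measureReal_birkhoffSum (hG : QuasiGibbs A φ μ C)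
    (hφc : Continuous φ) {qs v v' I : ℝ} (hqs : qs ∈ Set.Ioo (-1 : ℝ) 0)
    (hlog : v < Real.log (Fintype.card A)) {ν : Measure (X A)} (hν : InvProb A ν)
    (hνeq : entropy A ν + (1 - qs) * ∫ x, φ x ∂ν = pressure A fun x => (1 - qs) * φ x)
    (hνv : -∫ x, φ x ∂ν < v) (hv0 : 0 ≤ v) (hvv : v < v') (hI0 : 0 ≤ I)
    (hI : ∀ q ∈ Set.Icc (-2 : ℝ) 1, q * v - pressure A (fun x => (1 - q) * φ x) ≤ I)
    {ε : ℝ} (hε : 0 < ε) :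
    ∀ᶠ n : ℕ in atTop, Real.exp (-(n * (I + ε))) / 2 ≤
      μ.real {x | -(n * v') ≤ birkhoffSum (shift A) φ n x} := by
  have hC := hG.nonneg
  obtain ⟨M, hM0, hM⟩ := exists_abs_le_of_continuous A hφc
  have hlarge (c : ℝ) {d : ℝ} (hd : 0 < d) : ∀ᶠ N : ℕ in atTop, c < N * d := by
    have := tendsto_natCast_atTop_atTop (R := ℝ).atTop_mul_const hd
    exact this.eventually_gt_atTop c
  obtain ⟨N, hN0, hN1, hN2, hN3⟩ := ((eventually_gt_atTop 0).and
    ((hlarge (5 * C) (show 0 < v + ∫ x, φ x ∂ν by linarith)).and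
    ((hlarge (5 * C + 2) hε).and (hlarge (1 + C) (half_pos (sub_pos.2 hvv)))))).exists
  have hN' : (0 : ℝ) < N := by exact_mod_cast hN0
  have hk : Tendsto (fun n : ℕ => n / N) atTop atTop := Nat.tendsto_div_const_atTop hN0.ne'
  filter_upwards [hk.eventually (hG.exists_eventually_le_sum_prod hφc hN0 hqs hlog hν hνeq hN1 hI),
    hlarge (N * M) (half_pos (sub_pos.2 hvv))] with n hn hn2
  obtain ⟨k, r, hr, rfl, hkdef⟩ : ∃ k r, r < N ∧ n = k * N + r ∧ n / N = k :=
    ⟨n / N, n % N, Nat.mod_lt _ hN0, (Nat.div_add_mod' n N).symm, rfl⟩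
  rw [hkdef] at hn
  have hk0 : (0 : ℝ) ≤ k := Nat.cast_nonneg k
  have hr0 : (0 : ℝ) ≤ r := Nat.cast_nonneg r
  refine le_trans ?_ (hG.sum_prod_le_measureReal_birkhoffSum hM hr.le (v := v) (v' := v') ?_)
  · refine le_trans ?_ (mul_le_mul_of_nonneg_left hn (by positivity))
    rw [← Real.exp_nat_mul, ← mul_div_assoc, ← Real.exp_add]
    refine div_le_div_of_nonneg_right (Real.exp_le_exp.2 ?_) two_pos.le
    have h1 := mul_le_mul_of_nonneg_left hN2.le hk0
    push_cast
    nlinarith [mul_nonneg hr0 hI0, mul_nonneg hr0 hε.le]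
  · have h1 := mul_le_mul_of_nonneg_left hN3.le hk0
    push_cast at hn2 ⊢
    nlinarith [mul_nonneg hr0 hv0, mul_nonneg hr0 (sub_pos.2 hvv).le]

end LowerAsymptotics

/-! ### The rate function and the large deviation principle -/

section Rate

variable {A} {φ : X A → ℝ} {μ : Measure (X A)} {C : ℝ} [IsProbabilityMeasure μ] [Nonempty A]

lemma Normalized.nonpos (hnorm : Normalized A φ) (x : X A) : φ x ≤ 0 := by
  have h : prepend A (x 0) (shift A x) = x := by
    ext i
    cases i <;> rfl
  rw [← Real.exp_le_one_iff, ← hnorm (shift A x)]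
  nth_rewrite 1 [← h]
  exact Finset.single_le_sum (f := fun a => Real.exp (φ (prepend A a (shift A x))))
    (fun _ _ => (Real.exp_pos _).le) (Finset.mem_univ _)

lemma lt_neg_infInt (hφc : Continuous φ) (hnorm : Normalized A φ)
    (hne : ∃ x, φ x ≠ -Real.log (Fintype.card A)) {v : ℝ} (hv : v ≤ Real.log (Fintype.card A)) :
    v < -infInt A φ := by
  obtain ⟨η, hη, hlt⟩ := exists_integral_lt_neg_log_card A hφc hnorm hne
  obtain ⟨M, -, hM⟩ := exists_abs_le_of_continuous A hφc
  have : infInt A φ ≤ ∫ x, φ x ∂η := by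
    refine csInf_le ⟨-M, ?_⟩ ⟨η, hη, rfl⟩
    rintro r ⟨ξ, hξ, rfl⟩
    have := hξ.1
    simpa using integral_mono (integrable_const (-M)) (integrable_of_continuous A hφc ξ)
      fun x => (abs_le.1 (hM x)).1
  linarith

lemma QuasiGibbs.exists_mem_Icc_le (hG : QuasiGibbs A φ μ C) (hφc : Continuous φ)
    (hinv : InvProb A μ) {qs v : ℝ} (hqs : qs ≤ 0) {ν : Measure (X A)} (hν : InvProb A ν)
    (hνeq : entropy A ν + (1 - qs) * ∫ x, φ x ∂ν = pressure A fun x => (1 - qs) * φ x)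
    (hνv : -∫ x, φ x ∂ν < v) (hv : v ≤ entropy A μ) (q : ℝ) :
    ∃ q' ∈ Set.Icc qs 0, q * v - pressure A (fun x => (1 - q) * φ x) ≤
      q' * v - pressure A (fun x => (1 - q') * φ x) := by
  rcases lt_or_ge q qs with h | h
  · refine ⟨qs, ⟨le_rfl, hqs⟩, ?_⟩
    have h1 := hG.le_pressure hφc (1 - q) hν
    nlinarith
  rcases le_or_gt q 0 with h0 | h0
  · exact ⟨q, ⟨h, h0⟩, le_rfl⟩
  · refine ⟨0, ⟨hqs, le_rfl⟩, ?_⟩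
    have h1 := hG.le_pressure hφc (1 - q) hinv
    have h2 := hG.entropy_eq hφc hinv
    rw [sub_zero, hG.pressure_one hφc]
    nlinarith

lemma QuasiGibbs.bddAbove_rate (hG : QuasiGibbs A φ μ C) (hφc : Continuous φ)
    (hinv : InvProb A μ) {qs v : ℝ} (hqs : qs ≤ 0) {ν : Measure (X A)} (hν : InvProb A ν)
    (hνeq : entropy A ν + (1 - qs) * ∫ x, φ x ∂ν = pressure A fun x => (1 - qs) * φ x)
    (hνv : -∫ x, φ x ∂ν < v) (hv : v ≤ entropy A μ) :
    BddAbove {r : ℝ | ∃ q : ℝ, r = q * v - pressure A (fun x => (1 - q) * φ x)} := by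
  refine ⟨-(entropy A ν + ∫ x, φ x ∂ν), ?_⟩
  rintro r ⟨q, rfl⟩
  obtain ⟨q', hq', h⟩ := hG.exists_mem_Icc_le hφc hinv hqs hν hνeq hνv hv q
  refine h.trans ?_
  have h1 := hG.le_pressure hφc (1 - q') hν
  have h2 := mul_nonneg (neg_nonneg.2 hq'.2) (show 0 ≤ v + ∫ x, φ x ∂ν by linarith)
  linarith

lemma tendsto_inv_mul_log {m : ℕ → ℝ} {I : ℝ}
    (hlow : ∀ ε > 0, ∃ c, ∀ᶠ n : ℕ in atTop, Real.exp (c + n * (I - ε)) ≤ m n)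
    (hupp : ∀ ε > 0, ∃ c, ∀ᶠ n : ℕ in atTop, m n ≤ Real.exp (c + n * (I + ε))) :
    Tendsto (fun n : ℕ => (n : ℝ)⁻¹ * Real.log (m n)) atTop (𝓝 I) := by
  refine Metric.tendsto_nhds.2 fun ε hε => ?_
  obtain ⟨c, hc⟩ := hlow (ε / 2) (half_pos hε)
  obtain ⟨d, hd⟩ := hupp (ε / 2) (half_pos hε)
  have hlarge (a : ℝ) : ∀ᶠ n : ℕ in atTop, a < n * (ε / 2) :=
    (tendsto_natCast_atTop_atTop.atTop_mul_const (half_pos hε)).eventually_gt_atTop a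
  filter_upwards [hc, hd, hlarge (-c), hlarge d, eventually_gt_atTop 0] with n h1 h2 h3 h4 hn
  have hn' : (0 : ℝ) < n := by exact_mod_cast hn
  have hm : 0 < m n := (Real.exp_pos _).trans_le h1
  rw [← Real.le_log_iff_exp_le hm] at h1
  rw [← Real.log_le_iff_le_exp hm] at h2
  rw [Real.dist_eq, abs_lt, lt_sub_iff_add_lt, sub_lt_iff_lt_add, lt_inv_mul_iff₀ hn',
    inv_mul_lt_iff₀ hn']
  constructor <;> linarith

lemma tendsto_inv_mul_ennreal_log {E : ℕ → Set (X A)} {I : ℝ}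
    (hlow : ∀ ε > 0, ∃ c, ∀ᶠ n : ℕ in atTop, Real.exp (c + n * (I - ε)) ≤ μ.real (E n))
    (hupp : ∀ ε > 0, ∃ c, ∀ᶠ n : ℕ in atTop, μ.real (E n) ≤ Real.exp (c + n * (I + ε))) :
    Tendsto (fun n : ℕ => (((n : ℝ)⁻¹ : ℝ) : EReal) * ENNReal.log (μ (E n))) atTop
      (𝓝 (I : EReal)) := by
  refine ((continuous_coe_real_ereal.tendsto I).comp (tendsto_inv_mul_log hlow hupp)).congr' ?_
  obtain ⟨c, hc⟩ := hlow 1 one_pos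
  filter_upwards [hc] with n hn
  have h0 : μ (E n) ≠ 0 := fun h => by
    rw [measureReal_def, h, ENNReal.toReal_zero] at hn
    exact (Real.exp_pos _).not_ge hn
  rw [ENNReal.log_pos_real h0 (measure_ne_top _ _), Function.comp_apply, EReal.coe_mul]
  rfl

lemma QuasiGibbs.exists_eventually_le_measureReal_retTime_lt (hG : QuasiGibbs A φ μ C)
    (hφc : Continuous φ) (hp : MeasurePreserving (shift A) μ μ) {qs v I : ℝ}
    (hqs : qs ∈ Set.Ioo (-1 : ℝ) 0) (hlog : v ≤ Real.log (Fintype.card A))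
    {ν : Measure (X A)} (hν : InvProb A ν)
    (hνeq : entropy A ν + (1 - qs) * ∫ x, φ x ∂ν = pressure A fun x => (1 - qs) * φ x)
    (hν0 : ∫ x, φ x ∂ν ≤ 0) (hνv : -∫ x, φ x ∂ν < v)
    (hI : ∀ q, q * v - pressure A (fun x => (1 - q) * φ x) ≤ I) {ε : ℝ} (hε : 0 < ε) :
    ∃ c, ∀ᶠ n : ℕ in atTop, Real.exp (c + n * (-I - ε)) ≤
      μ.real {x | 1 / (n : ℝ) * Real.log (retTime A n x) < v} := by
  obtain ⟨w, hw1, hw2⟩ := exists_between (max_lt hνv (show v - ε / 4 < v by linarith))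
  obtain ⟨hw3, hw4⟩ := max_lt_iff.1 hw1
  obtain ⟨w', hw5, hw6⟩ := exists_between hw2
  have hI0 : 0 ≤ I := by
    have h := hI 0
    simp only [sub_zero, one_mul, zero_mul] at h
    have h1 := hG.pressure_one hφc
    simp only [one_mul] at h1
    linarith
  have h1 := hG.eventually_le_measureReal_birkhoffSum hφc hqs (hw2.trans_le hlog) hν hνeq hw3
    (by linarith) hw5 (I := I + ε / 2) (by linarith)
    (fun q hq => by nlinarith [hI q, hq.1, hq.2]) (half_pos hε)
  have h2 := hG.eventually_le_measureReal_retTime_lt hp (v := v) (v' := w') (by linarith) hw6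
  refine ⟨-(2 * C) - Real.log 4, ?_⟩
  filter_upwards [h1, h2] with n h1 h2
  refine le_trans ?_ ((mul_le_mul_of_nonneg_left h1 (by positivity)).trans h2)
  refine le_of_eq ?_
  rw [Real.exp_add, Real.exp_sub, Real.exp_log (by norm_num)]
  ring_nf

lemma QuasiGibbs.exists_eventually_measureReal_retTime_lt_le (hG : QuasiGibbs A φ μ C)
    (hφc : Continuous φ) (hp : MeasurePreserving (shift A) μ μ) {v q I : ℝ} (hq0 : q ≤ 0)
    (hq1 : -1 ≤ q) (hsup : supInt A φ ≤ pressure A (fun x => (1 - q) * φ x) - q * v) {ε : ℝ}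
    (hε : 0 < ε) (hI : I - ε / 2 ≤ q * v - pressure A (fun x => (1 - q) * φ x)) :
    ∃ c, ∀ᶠ n : ℕ in atTop, μ.real {x | 1 / (n : ℝ) * Real.log (retTime A n x) < v} ≤
      Real.exp (c + n * (-I + ε)) := by
  refine ⟨Real.log (2 / ε + 1) + 4 * C, ?_⟩
  filter_upwards [eventually_gt_atTop 0] with n hn
  have hn' : (0 : ℝ) < n := by exact_mod_cast hn
  refine (hG.measureReal_retTime_lt_le hφc hp hn hq0 hq1 hsup).trans ?_
  have h1 : (n + 1 : ℝ) ≤ (2 / ε + 1) * Real.exp (n * (ε / 2)) := by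
    have h2 := Real.add_one_le_exp (n * (ε / 2))
    refine le_trans ?_ (mul_le_mul_of_nonneg_left h2 (by positivity))
    have : (2 / ε + 1) * (n * (ε / 2) + 1) = n + 1 + (n * (ε / 2) + 2 / ε) := by
      field_simp
      ring
    rw [this]
    have : 0 ≤ n * (ε / 2) + 2 / ε := by positivity
    linarith
  refine (mul_le_mul_of_nonneg_right h1 (Real.exp_pos _).le).trans ?_
  rw [← Real.exp_log (show 0 < 2 / ε + 1 by positivity), ← Real.exp_add, ← Real.exp_add,
    Real.exp_le_exp, Real.exp_log (by positivity)]
  nlinarith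

end Rate

/-- large deviations below the entropy: for every
`u ∈ [0, h(μ_φ) + ∫ φ dμ_{(1-q*_φ)φ})`,
`lim_n (1/n) log μ_φ{x : (1/n) log R_n(x) < h(μ_φ) - u} = -ℐ_φ(h(μ_φ)-u)`. -/
theorem large_deviations_below_entropy
    (hcard : 1 < Fintype.card A)
    (φ : X A → ℝ) (hφc : Continuous φ)
    (hvar : Summable (fun n => Var A φ (n + 1)))
    (hnorm : Normalized A φ)
    (μφ : Measure (X A)) (hμ : IsEqSt A φ μφ)
    (hnot : ¬ ∃ u : X A → ℝ, Continuous u ∧ ∀ x, φ x = u x - u (shift A x) - Real.log (Fintype.card A))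
    (qs : ℝ) (hqs : qs ∈ Set.Ioo (-1 : ℝ) 0)
    (hqs' : pressure A (fun x => (1 - qs) * φ x) = supInt A φ)
    (ν : Measure (X A)) (hν : InvProb A ν)
    (hνeq : entropy A ν + ∫ x, (1 - qs) * φ x ∂ν = pressure A (fun x => (1 - qs) * φ x)) :
    ∀ u : ℝ, 0 ≤ u → u < entropy A μφ + ∫ x, φ x ∂ν →
      Tendsto (fun n : ℕ => (((n : ℝ)⁻¹ : ℝ) : EReal) *
          ENNReal.log (μφ {x : X A |
            (1 / (n : ℝ)) * Real.log ((retTime A n x : ℝ)) < entropy A μφ - u}))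
        atTop (nhds (- rateFn A φ (entropy A μφ - u))) := by
  have hne : Nonempty A := Fintype.card_pos_iff.1 (by omega)
  have hprob := hμ.1
  obtain ⟨C, hG⟩ := exists_quasiGibbs A hφc hvar hμ
  have hp := measurePreserving_shift A hφc hnorm hμ
  have hinv : InvProb A μφ := ⟨hprob, hp.map_eq⟩
  intro u hu0 hu
  set v := entropy A μφ - u with hv
  rw [integral_const_mul] at hνeq
  have hν0 : ∫ x, φ x ∂ν ≤ 0 := integral_nonpos hnorm.nonpos
  have hνv : -∫ x, φ x ∂ν < v := by linarith
  have hvh : v ≤ entropy A μφ := by linarith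
  have hlog : v ≤ Real.log (Fintype.card A) := hvh.trans (hG.entropy_le_log_card hφc hinv)
  have hex : ∃ x, φ x ≠ -Real.log (Fintype.card A) := by
    by_contra! h
    exact hnot ⟨fun _ => 0, continuous_const, fun x => by simp [h x]⟩
  rw [rateFn, if_pos (lt_neg_infInt hφc hnorm hex hlog), ← EReal.coe_neg]
  set I := sSup {r : ℝ | ∃ q : ℝ, r = q * v - pressure A (fun x => (1 - q) * φ x)} with hI
  have hbdd := hG.bddAbove_rate hφc hinv hqs.2.le hν hνeq hνv hvh
  refine tendsto_inv_mul_ennreal_log (fun ε hε => ?_) fun ε hε => ?_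
  · exact hG.exists_eventually_le_measureReal_retTime_lt hφc hp hqs hlog hν hνeq hν0 hνv
      (fun q => le_csSup hbdd ⟨q, rfl⟩) hε
  · obtain ⟨r, ⟨q, rfl⟩, hr⟩ := exists_lt_of_lt_csSup
      (s := {r : ℝ | ∃ q : ℝ, r = q * v - pressure A (fun x => (1 - q) * φ x)})
      ⟨_, 0, rfl⟩ (show I - ε / 2 < I by linarith)
    obtain ⟨q', hq', hle⟩ := hG.exists_mem_Icc_le hφc hinv hqs.2.le hν hνeq hνv hvh q
    refine hG.exists_eventually_measureReal_retTime_lt_le hφc hp hq'.2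
      (by linarith [hqs.1, hq'.1]) ?_ hε (hr.le.trans hle)
    have h1 := hG.le_pressure hφc (1 - q') hν
    rw [← hqs', ← hνeq]
    nlinarith [hq'.1, hq'.2]

end RTSpec
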